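/- arXiv:2502.14498 — 4 statements merged into one kernel-verified Lean document; each statement's English description precedes it below -/
import Mathlib

section
/- Let K : ℝ → ℝ be a square-integrable, symmetric, integrable kernel function (∫K(x)dx = 1), and assume s_t ∈ L²(ℝ²). Then for every 𝐡 = (h₁,h₂) ∈ (0,1]², E(‖ŝ_{𝐡,t} − s_t‖²) ≤ ‖Q_𝐡 ⋆ s_t − s_t‖² + ‖K‖⁴/(N h₁ h₂), where ‖K‖⁴ = (∫K(x)²dx)². (Proposition 3.1, first inequality.) -/
open MeasureTheory ProbabilityTheory Real

/-- Scaled kernel `K_h(x) = (1/h) K(x/h)`. -/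
noncomputable def Kh (K : ℝ → ℝ) (h x : ℝ) : ℝ := h⁻¹ * K (x / h)

/-- Product kernel `Q_𝐡(x,y) = K_{h₁}(x) K_{h₂}(y)`. -/
noncomputable def Qker (K : ℝ → ℝ) (h₁ h₂ x y : ℝ) : ℝ := Kh K h₁ x * Kh K h₂ y

theorem aux_jensen_pt {B : Type*} [MeasurableSpace B] {ν : Measure B} [IsProbabilityMeasure ν]
    {f : B → ℝ} (hf : MemLp f 2 ν) : (∫ b, f b ∂ν) ^ 2 ≤ ∫ b, f b ^ 2 ∂ν := by
  have h := variance_eq_sub hf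
  have h2 := variance_nonneg f ν
  simp only [Pi.pow_apply] at h
  linarith

theorem aux_section {A B : Type*} [MeasurableSpace A] [MeasurableSpace B] {μ : Measure A}
    [SFinite μ] {ν : Measure B} [SFinite ν] {q : A × B → ℝ}
    (hq : MemLp q 2 (μ.prod ν)) : ∀ᵐ a ∂μ, MemLp (fun b => q (a, b)) 2 ν := by
  filter_upwards [hq.1.prodMk_left, hq.integrable_sq.prod_right_ae] with a h1 h2
  exact (memLp_two_iff_integrable_sq h1).2 h2

theorem aux_jensen {A B : Type*} [MeasurableSpace A] [MeasurableSpace B] {μ : Measure A}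
    [SFinite μ] {ν : Measure B} [IsProbabilityMeasure ν] {q : A × B → ℝ}
    (hq : MemLp q 2 (μ.prod ν)) : MemLp (fun a => ∫ b, q (a, b) ∂ν) 2 μ := by
  have hm : AEStronglyMeasurable (fun a => ∫ b, q (a, b) ∂ν) μ := hq.1.integral_prod_right'
  rw [memLp_two_iff_integrable_sq hm]
  refine hq.integrable_sq.integral_prod_left.mono' (hm.pow 2) ?_
  filter_upwards [aux_section hq] with a ha
  rw [Real.norm_of_nonneg (sq_nonneg _)]
  exact aux_jensen_pt ha

theorem aux_cov {Ω S : Type*} [MeasurableSpace Ω] [MeasurableSpace S] {P : Measure Ω}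
    [IsProbabilityMeasure P] {ν : Measure S} [IsProbabilityMeasure ν] {q r : Ω × S → ℝ}
    (hqm : Measurable q) (hrm : Measurable r)
    (hq : MemLp q 2 (P.prod ν)) (hr : MemLp r 2 (P.prod ν))
    (hind : ∀ s u, IndepFun (fun ω => q (ω, s)) (fun ω => r (ω, u)) P) :
    cov[fun ω => ∫ s, q (ω, s) ∂ν, fun ω => ∫ s, r (ω, s) ∂ν; P] = 0 := by
  rw [covariance_eq_sub (aux_jensen hq) (aux_jensen hr)]
  have e1 : ∫ ω, ((fun ω => ∫ s, q (ω, s) ∂ν) * (fun ω => ∫ s, r (ω, s) ∂ν)) ω ∂P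
      = ∫ ω, ∫ p, q (ω, p.1) * r (ω, p.2) ∂(ν.prod ν) ∂P := by
    congr 1
    ext ω
    rw [integral_prod_mul (fun s => q (ω, s)) (fun s => r (ω, s))]
    rfl
  have i1 : MemLp (fun x : Ω × (S × S) => q (x.1, x.2.1)) 2 (P.prod (ν.prod ν)) :=
    hq.comp_measurePreserving ((MeasurePreserving.id P).prod (measurePreserving_fst (μ := ν) (ν := ν)))
  have i2 : MemLp (fun x : Ω × (S × S) => r (x.1, x.2.2)) 2 (P.prod (ν.prod ν)) :=
    hr.comp_measurePreserving ((MeasurePreserving.id P).prod (measurePreserving_snd (μ := ν) (ν := ν)))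
  have hq1 : Integrable q (P.prod ν) := hq.integrable (by norm_num)
  have hr1 : Integrable r (P.prod ν) := hr.integrable (by norm_num)
  rw [e1, integral_integral_swap (i1.integrable_mul i2)]
  have e2 : ∀ p : S × S, ∫ ω, q (ω, p.1) * r (ω, p.2) ∂P
      = (∫ ω, q (ω, p.1) ∂P) * (∫ ω, r (ω, p.2) ∂P) := fun p =>
    (hind p.1 p.2).integral_mul_eq_mul_integral
      (hqm.comp (by fun_prop : Measurable fun ω : Ω => (ω, p.1))).aestronglyMeasurable
      (hrm.comp (by fun_prop : Measurable fun ω : Ω => (ω, p.2))).aestronglyMeasurable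
  simp only [e2]
  rw [integral_prod_mul (fun s => ∫ ω, q (ω, s) ∂P) (fun s => ∫ ω, r (ω, s) ∂P),
    integral_integral_swap (f := fun ω s => q (ω, s)) hq1,
    integral_integral_swap (f := fun ω s => r (ω, s)) hr1]
  ring

theorem aux_pointwise {Ω S : Type*} [MeasurableSpace Ω] [MeasurableSpace S] {P : Measure Ω}
    [IsProbabilityMeasure P] {ν : Measure S} [IsProbabilityMeasure ν] {q : ℕ → Ω × S → ℝ}
    (hqm : ∀ i, Measurable (q i)) (hq : ∀ i, MemLp (q i) 2 (P.prod ν))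
    (hind : ∀ i j, i ≠ j → ∀ s u, IndepFun (fun ω => q i (ω, s)) (fun ω => q j (ω, u)) P)
    (N : ℕ) (hN : 0 < N) (m c : ℝ) (hm : ∀ i, ∫ a, q i a ∂(P.prod ν) = m) :
    ∫ ω, ((N : ℝ)⁻¹ * (∑ i ∈ Finset.range N, ∫ s, q i (ω, s) ∂ν) - c) ^ 2 ∂P
      ≤ (m - c) ^ 2 + ((N : ℝ)⁻¹) ^ 2 *
          ∑ i ∈ Finset.range N, ∫ a, q i a ^ 2 ∂(P.prod ν) := by
  set Y : ℕ → Ω → ℝ := fun i ω => ∫ s, q i (ω, s) ∂ν with hY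
  have hN' : (N : ℝ) ≠ 0 := by positivity
  have hYL : ∀ i, MemLp (Y i) 2 P := fun i => aux_jensen (hq i)
  have hYm : ∀ i, ∫ ω, Y i ω ∂P = m := fun i => by
    rw [← hm i, integral_prod _ ((hq i).integrable (by norm_num))]
  have hSL : MemLp (∑ i ∈ Finset.range N, Y i) 2 P := memLp_finsetSum' _ fun i _ => hYL i
  have hAL : MemLp (fun ω => (N : ℝ)⁻¹ * (∑ i ∈ Finset.range N, Y i) ω) 2 P := hSL.const_mul _
  have hBL : MemLp (fun ω => (N : ℝ)⁻¹ * (∑ i ∈ Finset.range N, Y i) ω - c) 2 P :=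
    hAL.sub (memLp_const c)
  have hv := variance_eq_sub hBL
  rw [variance_sub_const hAL.1, variance_const_mul, variance_sum' fun i _ => hYL i] at hv
  have hmean : ∫ ω, ((N : ℝ)⁻¹ * (∑ i ∈ Finset.range N, Y i) ω - c) ∂P = m - c := by
    rw [integral_sub (hAL.integrable (by norm_num)) (integrable_const c), integral_const_mul]
    simp only [Finset.sum_apply]
    rw [integral_finsetSum _ fun i _ => (hYL i).integrable (by norm_num)]
    simp [hYm, hN']
  have hcov : ∑ i ∈ Finset.range N, ∑ j ∈ Finset.range N, cov[Y i, Y j; P]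
      ≤ ∑ i ∈ Finset.range N, ∫ a, q i a ^ 2 ∂(P.prod ν) := by
    refine Finset.sum_le_sum fun i hi => ?_
    rw [Finset.sum_eq_single_of_mem i hi fun j _ hji =>
      aux_cov (hqm i) (hqm j) (hq i) (hq j) (hind i j hji.symm),
      covariance_self (hYL i).1.aemeasurable]
    refine (variance_le_expectation_sq (hYL i).1).trans ?_
    rw [integral_prod _ (hq i).integrable_sq]
    refine integral_mono_ae (hYL i).integrable_sq (hq i).integrable_sq.integral_prod_left ?_
    filter_upwards [aux_section (hq i)] with ω hω
    exact aux_jensen_pt hω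
  rw [hmean] at hv
  have := mul_le_mul_of_nonneg_left hcov (sq_nonneg (N : ℝ)⁻¹)
  simp only [Pi.pow_apply, Finset.sum_apply] at hv
  linarith

theorem aux_core {Ω S : Type*} [MeasurableSpace Ω] [MeasurableSpace S] {P : Measure Ω}
    [IsProbabilityMeasure P] {ν : Measure S} [IsProbabilityMeasure ν]
    {Z : ℕ → Ω × S → ℝ × ℝ} (hZ : ∀ i, Measurable (Z i))
    (hind : ∀ i j, i ≠ j → ∀ s u, IndepFun (fun ω => Z i (ω, s)) (fun ω => Z j (ω, u)) P)
    {G : ℝ × ℝ → ℝ} (hGm : Measurable G) (hG : MemLp G 2 volume)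
    {f : ℝ × ℝ → ℝ} (hfm : Measurable f) (hf0 : ∀ z, 0 ≤ f z) (hf : MemLp f 2 volume)
    (hlaw : ∀ i, (P.prod ν).map (Z i) = volume.withDensity fun z => ENNReal.ofReal (f z))
    (N : ℕ) (hN : 0 < N) :
    ∫ ω, (∫ z, ((N : ℝ)⁻¹ * (∑ i ∈ Finset.range N, ∫ s, G (Z i (ω, s) - z) ∂ν) - f z) ^ 2) ∂P
      ≤ (∫ z, ((∫ w, G (w - z) * f w) - f z) ^ 2) + (N : ℝ)⁻¹ * ∫ w, G w ^ 2 := by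
  have hN' : (N : ℝ) ≠ 0 := by positivity
  -- the basic measure preserving map
  have τ : ∀ i, MeasurePreserving (fun x : (Ω × S) × (ℝ × ℝ) => Z i x.1 - x.2)
      ((P.prod ν).prod volume) volume := fun i =>
    (measurePreserving_snd (μ := P.prod ν) (ν := (volume : Measure (ℝ × ℝ)))).comp
      (MeasurePreserving.skew_product (MeasurePreserving.id (P.prod ν))
        (g := fun a z => Z i a - z)
        (by have := hZ i; unfold Function.uncurry; fun_prop)
        (Filter.Eventually.of_forall fun a =>
          (Measure.measurePreserving_sub_left volume (Z i a)).map_eq))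
  have ρ : MeasurePreserving (fun x : (Ω × (ℝ × ℝ)) × S => ((x.1.1, x.2), x.1.2))
      ((P.prod volume).prod ν) ((P.prod ν).prod volume) :=
    ((measurePreserving_prodAssoc P ν (volume : Measure (ℝ × ℝ))).symm).comp
     (((MeasurePreserving.id P).prod
      (Measure.measurePreserving_swap (μ := (volume : Measure (ℝ × ℝ))) (ν := ν))).comp
      (measurePreserving_prodAssoc P (volume : Measure (ℝ × ℝ)) ν))
  have L0 : ∀ i, MemLp (fun x : (Ω × S) × (ℝ × ℝ) => G (Z i x.1 - x.2)) 2
      ((P.prod ν).prod volume) := fun i => hG.comp_measurePreserving (τ i)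
  have L0' : ∀ i, MemLp (fun x : (ℝ × ℝ) × (Ω × S) => G (Z i x.2 - x.1)) 2
      ((volume : Measure (ℝ × ℝ)).prod (P.prod ν)) := fun i =>
    (L0 i).comp_measurePreserving Measure.measurePreserving_swap
  have L1 : ∀ i, MemLp (fun x : (Ω × (ℝ × ℝ)) × S => G (Z i (x.1.1, x.2) - x.1.2)) 2
      ((P.prod volume).prod ν) := fun i => (L0 i).comp_measurePreserving ρ
  have L2 : ∀ i, MemLp (fun x : Ω × (ℝ × ℝ) => ∫ s, G (Z i (x.1, s) - x.2) ∂ν) 2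
      (P.prod volume) := fun i => aux_jensen (L1 i)
  have L3 : MemLp (fun x : Ω × (ℝ × ℝ) =>
      (N : ℝ)⁻¹ * (∑ i ∈ Finset.range N, ∫ s, G (Z i (x.1, s) - x.2) ∂ν) - f x.2) 2
      (P.prod volume) :=
    ((memLp_finsetSum _ fun i _ => L2 i).const_mul _).sub
      (hf.comp_measurePreserving measurePreserving_snd)
  have hmean : ∀ i z, ∫ a, G (Z i a - z) ∂(P.prod ν) = ∫ w, G (w - z) * f w := by
    intro i z
    have h1 : ∫ a, G (Z i a - z) ∂(P.prod ν) = ∫ w, G (w - z) ∂((P.prod ν).map (Z i)) := by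
      rw [integral_map (hZ i).aemeasurable]
      exact (by fun_prop : Measurable fun w : ℝ × ℝ => G (w - z)).aestronglyMeasurable
    rw [h1, hlaw i, integral_withDensity_eq_integral_toReal_smul (by fun_prop) (by simp)]
    congr 1
    ext w
    rw [ENNReal.toReal_ofReal (hf0 w), smul_eq_mul, mul_comm]
  have hmL : MemLp (fun z => ∫ w, G (w - z) * f w) 2 volume := by
    have := aux_jensen (L0' 0)
    simpa only [hmean] using this
  have hsq : ∀ i, Integrable (fun z => ∫ a, G (Z i a - z) ^ 2 ∂(P.prod ν)) volume := fun i =>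
    (L0' i).integrable_sq.integral_prod_left
  have hsqv : ∀ i, ∫ z, ∫ a, G (Z i a - z) ^ 2 ∂(P.prod ν) = ∫ w, G w ^ 2 := by
    intro i
    have := integral_prod_symm _ (L0 i).integrable_sq
    simp only at this
    rw [← this]
    conv_rhs => rw [← (τ i).map_eq]
    rw [integral_map (τ i).measurable.aemeasurable]
    exact (hGm.pow_const 2).aestronglyMeasurable
  rw [integral_integral_swap (f := fun ω z => ((N : ℝ)⁻¹ * (∑ i ∈ Finset.range N,
    ∫ s, G (Z i (ω, s) - z) ∂ν) - f z) ^ 2) L3.integrable_sq]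
  have I1 : Integrable (fun z => ((∫ w, G (w - z) * f w) - f z) ^ 2) volume :=
    (hmL.sub hf).integrable_sq
  have I2 : Integrable (fun z => ((N : ℝ)⁻¹) ^ 2 *
      ∑ i ∈ Finset.range N, ∫ a, G (Z i a - z) ^ 2 ∂(P.prod ν)) volume :=
    (integrable_finsetSum _ fun i _ => hsq i).const_mul _
  have key : ∫ z, ∫ ω, ((N : ℝ)⁻¹ * (∑ i ∈ Finset.range N,
      ∫ s, G (Z i (ω, s) - z) ∂ν) - f z) ^ 2 ∂P
      ≤ ∫ z, (((∫ w, G (w - z) * f w) - f z) ^ 2 + ((N : ℝ)⁻¹) ^ 2 *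
      ∑ i ∈ Finset.range N, ∫ a, G (Z i a - z) ^ 2 ∂(P.prod ν)) := by
    refine integral_mono_of_nonneg
      (Filter.Eventually.of_forall fun z => integral_nonneg fun ω => sq_nonneg _) (I1.add I2) ?_
    have hae : ∀ᵐ z ∂(volume : Measure (ℝ × ℝ)), ∀ i,
        MemLp (fun a => G (Z i a - z)) 2 (P.prod ν) :=
      ae_all_iff.2 fun i => aux_section (L0' i)
    filter_upwards [hae] with z hz
    refine aux_pointwise (q := fun i a => G (Z i a - z))
      (fun i => by have := hZ i; fun_prop) hz ?_ N hN _ _ fun i => hmean i z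
    intro i j hij s u
    have hGz : Measurable fun w : ℝ × ℝ => G (w - z) := by fun_prop
    exact (hind i j hij s u).comp hGz hGz
  refine key.trans (le_of_eq ?_)
  rw [integral_add I1 I2, integral_const_mul, integral_finsetSum _ fun i _ => hsq i]
  simp only [hsqv, Finset.sum_const, Finset.card_range, nsmul_eq_mul]
  field_simp

theorem aux_law {Ω : Type*} [MeasurableSpace Ω] {P : Measure Ω}
    [IsProbabilityMeasure P] {ν : Measure ℝ} [IsProbabilityMeasure ν]
    {Z : Ω × ℝ → ℝ × ℝ} (hZ : Measurable Z) {p : ℝ → ℝ × ℝ → ℝ}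
    (hp : Measurable (fun q : ℝ × (ℝ × ℝ) => p q.1 q.2)) (hp0 : ∀ s z, 0 ≤ p s z)
    (hd : ∀ᵐ s ∂ν, P.map (fun ω => Z (ω, s)) =
      volume.withDensity fun z => ENNReal.ofReal (p s z)) :
    (P.prod ν).map Z = volume.withDensity fun z => ENNReal.ofReal (∫ s, p s z ∂ν) := by
  have hlin : (P.prod ν).map Z = volume.withDensity fun z => ∫⁻ s, ENNReal.ofReal (p s z) ∂ν := by
    ext A hA
    rw [Measure.map_apply hZ hA, Measure.prod_apply_symm (hZ hA), withDensity_apply _ hA,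
      lintegral_lintegral_swap (by fun_prop)]
    refine lintegral_congr_ae ?_
    filter_upwards [hd] with s hs
    rw [← withDensity_apply _ hA, ← hs, Measure.map_apply (by fun_prop) hA]
    rfl
  rw [hlin]
  refine withDensity_congr_ae ?_
  have hprob : ∫⁻ z, ∫⁻ s, ENNReal.ofReal (p s z) ∂ν ≠ ⊤ := by
    have : (P.prod ν).map Z Set.univ ≠ ⊤ := by
      rw [Measure.map_apply hZ MeasurableSet.univ]
      exact measure_ne_top _ _
    rwa [hlin, withDensity_apply _ MeasurableSet.univ, Measure.restrict_univ] at this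
  have hm : Measurable fun z => ∫⁻ s, ENNReal.ofReal (p s z) ∂ν :=
    Measurable.lintegral_prod_left' (f := fun q : ℝ × (ℝ × ℝ) => ENNReal.ofReal (p q.1 q.2))
      (by fun_prop)
  filter_upwards [ae_lt_top hm hprob] with z hz
  have hpm : Measurable fun s => p s z := hp.comp (by fun_prop : Measurable fun s => (s, z))
  rw [ofReal_integral_eq_lintegral_ofReal _ (Filter.Eventually.of_forall fun s => hp0 s z)]
  refine ⟨hpm.aestronglyMeasurable, ?_⟩
  rw [hasFiniteIntegral_iff_ofReal (Filter.Eventually.of_forall fun s => hp0 s z)]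
  exact hz

theorem aux_Kh {K : ℝ → ℝ} (hKsq : MemLp K 2 (volume : Measure ℝ))
    {h : ℝ} (hh : 0 < h) :
    Integrable (fun x => Kh K h x ^ 2) ∧ ∫ x, Kh K h x ^ 2 = h⁻¹ * ∫ x, K x ^ 2 := by
  have e : (fun x => Kh K h x ^ 2) = fun x => h⁻¹ ^ 2 * (K (x / h)) ^ 2 := by
    ext x; unfold Kh; ring
  rw [e]
  refine ⟨(hKsq.integrable_sq.comp_div hh.ne').const_mul _, ?_⟩
  rw [integral_const_mul, Measure.integral_comp_div (fun x => K x ^ 2), abs_of_pos hh, smul_eq_mul]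
  field_simp

/-- Proposition 3.1, first inequality.
`E(‖ŝ_{𝐡,t} − s_t‖²) ≤ ‖Q_𝐡 ⋆ s_t − s_t‖² + ‖K‖⁴/(N h₁ h₂)`. -/
theorem risk_bound_numerator_NW_unweighted
    {Ω : Type*} [MeasurableSpace Ω] (P : Measure Ω) [IsProbabilityMeasure P]
    (K : ℝ → ℝ) (hKmeas : Measurable K)
    (hKsq : MemLp K 2 (volume : Measure ℝ))
    (hKsym : ∀ x, K (-x) = K x)
    (hKint : Integrable K (volume : Measure ℝ)) (hKone : ∫ x, K x = 1)
    (t₀ T t : ℝ) (ht₀ : 0 ≤ t₀) (htT : t₀ < T) (ht : t ∈ Set.Ioc 0 T)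
    (N : ℕ) (hN : 0 < N)
    (X : ℕ → Ω → ℝ → ℝ)
    (hXmeas : ∀ i, Measurable (fun q : Ω × ℝ => X i q.1 q.2))
    (hindep : iIndepFun (m := fun _ : ℕ => (inferInstance : MeasurableSpace (ℝ → ℝ)))
      (fun i ω => X i ω) P)
    (pst : ℝ → ℝ → ℝ → ℝ)
    (hpstmeas : Measurable (fun q : ℝ × ℝ × ℝ => pst q.1 q.2.1 q.2.2))
    (hpstpos : ∀ s ξ ζ, 0 ≤ pst s ξ ζ)
    (hdensity : ∀ i, ∀ s ∈ Set.Icc t₀ T,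
      P.map (fun ω => (X i ω s, X i ω (s + t))) =
        (volume : Measure (ℝ × ℝ)).withDensity
          (fun z => ENNReal.ofReal (pst s z.1 z.2)))
    (st : ℝ → ℝ → ℝ)
    (hst : ∀ ξ ζ, st ξ ζ = (T - t₀)⁻¹ * ∫ s in t₀..T, pst s ξ ζ)
    (hstL2 : MemLp (fun z : ℝ × ℝ => st z.1 z.2) 2 (volume : Measure (ℝ × ℝ)))
    (h₁ h₂ : ℝ) (hh₁ : h₁ ∈ Set.Ioc (0 : ℝ) 1) (hh₂ : h₂ ∈ Set.Ioc (0 : ℝ) 1) :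
    ∫ ω, (∫ z : ℝ × ℝ,
        (((N : ℝ) * (T - t₀))⁻¹ * (∑ i ∈ Finset.range N,
            ∫ s in t₀..T, Qker K h₁ h₂ (X i ω s - z.1) (X i ω (s + t) - z.2))
          - st z.1 z.2) ^ 2) ∂P
      ≤ (∫ z : ℝ × ℝ,
          ((∫ w : ℝ × ℝ, Qker K h₁ h₂ (z.1 - w.1) (z.2 - w.2) * st w.1 w.2)
            - st z.1 z.2) ^ 2)
        + (∫ x, K x ^ 2) ^ 2 / ((N : ℝ) * h₁ * h₂) := by
  set ν : Measure ℝ := ENNReal.ofReal (T - t₀)⁻¹ • volume.restrict (Set.Ioc t₀ T) with hν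
  have hL : 0 < T - t₀ := sub_pos.2 htT
  have hν1 : IsProbabilityMeasure ν := ⟨by
    rw [hν, Measure.smul_apply, Measure.restrict_apply_univ, Real.volume_Ioc, smul_eq_mul,
      ← ENNReal.ofReal_mul (by positivity), inv_mul_cancel₀ hL.ne', ENNReal.ofReal_one]⟩
  have hνint : ∀ g : ℝ → ℝ, ∫ s, g s ∂ν = (T - t₀)⁻¹ * ∫ s in t₀..T, g s := by
    intro g
    rw [hν, integral_smul_measure, ENNReal.toReal_ofReal (by positivity), smul_eq_mul,
      intervalIntegral.integral_of_le htT.le]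
  have hνae : ∀ᵐ s ∂ν, s ∈ Set.Icc t₀ T := by
    refine Measure.ae_smul_measure ?_ _
    filter_upwards [ae_restrict_mem measurableSet_Ioc] with s hs using Set.Ioc_subset_Icc_self hs
  have hKhm : ∀ h, Measurable (Kh K h) := fun h => by unfold Kh; fun_prop
  have hGm : Measurable (fun w : ℝ × ℝ => Qker K h₁ h₂ w.1 w.2) := by
    have := hKhm h₁
    have := hKhm h₂
    unfold Qker; fun_prop
  have hk1 := aux_Kh hKsq hh₁.1
  have hk2 := aux_Kh hKsq hh₂.1
  have hG2 : (fun w : ℝ × ℝ => Qker K h₁ h₂ w.1 w.2 ^ 2)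
      = fun w => Kh K h₁ w.1 ^ 2 * Kh K h₂ w.2 ^ 2 := by
    ext w; unfold Qker; ring
  have hG : MemLp (fun w : ℝ × ℝ => Qker K h₁ h₂ w.1 w.2) 2 volume := by
    rw [memLp_two_iff_integrable_sq hGm.aestronglyMeasurable, hG2]
    exact hk1.1.mul_prod hk2.1
  have hGi : ∫ w : ℝ × ℝ, Qker K h₁ h₂ w.1 w.2 ^ 2 = (∫ x, K x ^ 2) ^ 2 * (h₁⁻¹ * h₂⁻¹) := by
    rw [hG2, Measure.volume_eq_prod,
      integral_prod_mul (fun x => Kh K h₁ x ^ 2) (fun x => Kh K h₂ x ^ 2), hk1.2, hk2.2]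
    ring
  have hGsym : ∀ x y, Qker K h₁ h₂ (-x) (-y) = Qker K h₁ h₂ x y := by
    intro x y; simp only [Qker, Kh, neg_div, hKsym]
  have hstf : (fun z : ℝ × ℝ => st z.1 z.2) = fun z => ∫ s, pst s z.1 z.2 ∂ν := by
    ext z; rw [hst, hνint]
  have hstm : Measurable (fun z : ℝ × ℝ => st z.1 z.2) := by
    rw [hstf]
    exact (StronglyMeasurable.integral_prod_left (f := fun (s : ℝ) (z : ℝ × ℝ) => pst s z.1 z.2)
      hpstmeas.stronglyMeasurable).measurable
  have hst0 : ∀ z : ℝ × ℝ, 0 ≤ st z.1 z.2 := fun z => by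
    rw [congrFun hstf z]; exact integral_nonneg fun s => hpstpos _ _ _
  have hZ : ∀ i, Measurable (fun a : Ω × ℝ => (X i a.1 a.2, X i a.1 (a.2 + t))) := fun i =>
    (hXmeas i).prodMk ((hXmeas i).comp (by fun_prop : Measurable fun a : Ω × ℝ => (a.1, a.2 + t)))
  have hlaw : ∀ i, (P.prod ν).map (fun a : Ω × ℝ => (X i a.1 a.2, X i a.1 (a.2 + t)))
      = volume.withDensity fun z => ENNReal.ofReal (st z.1 z.2) := fun i => by
    have := aux_law (P := P) (ν := ν) (hZ i) (p := fun s z => pst s z.1 z.2) hpstmeas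
      (fun _ _ => hpstpos _ _ _) (by filter_upwards [hνae] with s hs using hdensity i s hs)
    rw [this]
    congr 1
    ext z
    rw [← congrFun hstf z]
  have hind : ∀ i j, i ≠ j → ∀ s u,
      IndepFun (fun ω => (X i ω s, X i ω (s + t))) (fun ω => (X j ω u, X j ω (u + t))) P := by
    intro i j hij s u
    have hev : ∀ s : ℝ, Measurable fun x : ℝ → ℝ => (x s, x (s + t)) := fun s => by fun_prop
    exact (hindep.indepFun hij).comp (hev s) (hev u)
  have main := aux_core (P := P) (ν := ν) hZ hind hGm hG hstm hst0 hstL2 hlaw N hN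
  have hconv : ∀ z : ℝ × ℝ, ∫ w : ℝ × ℝ, Qker K h₁ h₂ (z.1 - w.1) (z.2 - w.2) * st w.1 w.2
      = ∫ w : ℝ × ℝ, Qker K h₁ h₂ (w - z).1 (w - z).2 * st w.1 w.2 := by
    intro z
    congr 1
    ext w
    rw [← hGsym, neg_sub, neg_sub, Prod.fst_sub, Prod.snd_sub]
  simp only [hconv]
  convert main using 1
  · congr 1
    ext ω
    congr 1
    ext z
    simp only [hνint, ← Finset.mul_sum]
    rw [mul_inv, mul_assoc]
    rfl
  · rw [hGi]
    congr 1
    rw [div_eq_mul_inv, mul_inv, mul_inv]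
    ring
end

section
/- Let K : ℝ → ℝ be a square-integrable, symmetric, integrable kernel function (∫K(x)dx = 1), assume s_t ∈ L²(ℝ²), and let δ : ℝ → [0,∞) be a measurable weight with δ(y) ≤ M for all y ∈ ℝ, where M > 0. Then for every 𝐡 = (h₁,h₂) ∈ (0,1]², E(‖ŝ_{𝐡,t} − s_t‖²_{1⊗δ}) ≤ ‖Q_𝐡 ⋆ s_t − s_t‖²_{1⊗δ} + M‖K‖⁴/(N h₁ h₂). (Proposition 3.1, second (weighted) inequality, with the weight f replaced by any bounded weight δ; in the paper δ = f and M = 𝔪_f(t₀,T).) -/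
open MeasureTheory ProbabilityTheory Real

lemma lemB {A B : Type*} [MeasurableSpace A] [MeasurableSpace B] (μ : Measure A) (ν : Measure B)
    [SFinite μ] [IsProbabilityMeasure ν] (G : A × B → ℝ) (hG : MemLp G 2 (μ.prod ν)) :
    MemLp (fun a => ∫ b, G (a, b) ∂ν) 2 μ ∧
      ∫ a, (∫ b, G (a, b) ∂ν) ^ 2 ∂μ ≤ ∫ q, G q ^ 2 ∂(μ.prod ν) := by
  have hsq : Integrable (fun q => G q ^ 2) (μ.prod ν) := hG.integrable_sq
  have hmeas : AEStronglyMeasurable (fun a => ∫ b, G (a, b) ∂ν) μ :=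
    hG.1.integral_prod_right'
  have hpt : ∀ᵐ a ∂μ, (∫ b, G (a, b) ∂ν) ^ 2 ≤ ∫ b, G (a, b) ^ 2 ∂ν := by
    filter_upwards [hsq.prod_right_ae, hG.1.prodMk_left] with a ha hm
    have hL : MemLp (fun b => G (a, b)) 2 ν := (memLp_two_iff_integrable_sq hm).2 ha
    have h0 := variance_nonneg (fun b => G (a, b)) ν
    rw [variance_eq_sub hL] at h0
    simpa using h0
  have hint : Integrable (fun a => ∫ b, G (a, b) ^ 2 ∂ν) μ := hsq.integral_prod_left
  have hint2 : Integrable (fun a => (∫ b, G (a, b) ∂ν) ^ 2) μ := by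
    refine hint.mono' (hmeas.pow 2) ?_
    filter_upwards [hpt] with a ha
    rw [Real.norm_of_nonneg (sq_nonneg _)]; exact ha
  refine ⟨(memLp_two_iff_integrable_sq hmeas).2 hint2, ?_⟩
  rw [integral_prod _ hsq]
  exact integral_mono_ae hint2 hint hpt

lemma lemA {Ω S : Type*} [MeasurableSpace Ω] [MeasurableSpace S] (P : Measure Ω) (ν : Measure S)
    [IsProbabilityMeasure P] [IsProbabilityMeasure ν] (N : ℕ) (hN : 0 < N)
    (G : ℕ → Ω × S → ℝ) (hGm : ∀ i, Measurable (G i)) (hG : ∀ i, MemLp (G i) 2 (P.prod ν))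
    (m : ℝ) (hm : ∀ i, ∫ q, G i q ∂(P.prod ν) = m)
    (hind : ∀ i j, i ≠ j → ∀ s u, IndepFun (fun ω => G i (ω, s)) (fun ω => G j (ω, u)) P)
    (C : ℝ) (hC : ∀ i, ∫ q, G i q ^ 2 ∂(P.prod ν) ≤ C) (a : ℝ) :
    ∫ ω, ((N : ℝ)⁻¹ * (∑ i ∈ Finset.range N, ∫ s, G i (ω, s) ∂ν) - a) ^ 2 ∂P
      ≤ (m - a) ^ 2 + C / N := by
  set Z : ℕ → Ω → ℝ := fun i ω => ∫ s, G i (ω, s) ∂ν with hZ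
  have hZL : ∀ i, MemLp (Z i) 2 P := fun i => (lemB P ν (G i) (hG i)).1
  have hZ2 : ∀ i, ∫ ω, Z i ω ^ 2 ∂P ≤ C := fun i => (lemB P ν (G i) (hG i)).2.trans (hC i)
  have hZm : ∀ i, ∫ ω, Z i ω ∂P = m := fun i => by
    rw [← hm i, integral_prod _ ((hG i).integrable (by norm_num))]
  have hcov : ∀ i j, i ≠ j → covariance (Z i) (Z j) P = 0 := by
    intro i j hij
    rw [covariance_eq_sub (hZL i) (hZL j), hZm, hZm, sub_eq_zero]
    have e1 : ∀ ω, (Z i * Z j) ω = ∫ q : S × S, G i (ω, q.1) * G j (ω, q.2) ∂(ν.prod ν) := by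
      intro ω
      rw [integral_prod_mul (fun s => G i (ω, s)) (fun s => G j (ω, s))]
      rfl
    have mp1 : MeasurePreserving (fun q : Ω × (S × S) => (q.1, q.2.1))
        (P.prod (ν.prod ν)) (P.prod ν) :=
      (MeasurePreserving.id P).prod measurePreserving_fst
    have mp2 : MeasurePreserving (fun q : Ω × (S × S) => (q.1, q.2.2))
        (P.prod (ν.prod ν)) (P.prod ν) :=
      (MeasurePreserving.id P).prod measurePreserving_snd
    have hI : Integrable (fun q : Ω × (S × S) => G i (q.1, q.2.1) * G j (q.1, q.2.2))
        (P.prod (ν.prod ν)) :=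
      ((hG i).comp_measurePreserving mp1).integrable_mul ((hG j).comp_measurePreserving mp2)
    rw [integral_congr_ae (Filter.Eventually.of_forall e1)]
    rw [integral_integral_swap hI]
    have e2 : ∀ q : S × S, ∫ ω, G i (ω, q.1) * G j (ω, q.2) ∂P
        = (∫ ω, G i (ω, q.1) ∂P) * ∫ ω, G j (ω, q.2) ∂P := by
      intro q
      exact (hind i j hij q.1 q.2).integral_fun_mul_eq_mul_integral
        ((hGm i).comp (by fun_prop)).aestronglyMeasurable
        ((hGm j).comp (by fun_prop)).aestronglyMeasurable
    simp_rw [e2]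
    rw [integral_prod_mul (fun s => ∫ ω, G i (ω, s) ∂P) (fun s => ∫ ω, G j (ω, s) ∂P)]
    rw [← integral_prod_symm _ ((hG i).integrable (by norm_num)),
      ← integral_prod_symm _ ((hG j).integrable (by norm_num)), hm, hm]
  have hN' : (0:ℝ) < N := by exact_mod_cast hN
  set Y : Ω → ℝ := fun ω => (N : ℝ)⁻¹ * (∑ i ∈ Finset.range N, Z i ω) - a with hY
  have hSL : MemLp (fun ω => ∑ i ∈ Finset.range N, Z i ω) 2 P := memLp_finsetSum _ fun i _ => hZL i
  have hYL : MemLp Y 2 P := (hSL.const_mul _).sub (memLp_const a)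
  have hYm : ∫ ω, Y ω ∂P = m - a := by
    rw [hY, integral_sub ((hSL.const_mul _).integrable (by norm_num)) (integrable_const _),
      integral_const_mul, integral_finsetSum _ fun i _ => (hZL i).integrable (by norm_num)]
    simp [hZm]
    field_simp
  have hv : variance Y P ≤ C / N := by
    rw [hY, variance_sub_const (hSL.const_mul _).1, variance_const_mul,
      variance_fun_sum' fun i _ => hZL i]
    have : ∀ i ∈ Finset.range N, ∑ j ∈ Finset.range N, covariance (Z i) (Z j) P ≤ C := by
      intro i hi
      rw [Finset.sum_eq_single_of_mem i hi fun j _ hj => hcov i j hj.symm,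
        covariance_self (hZL i).1.aemeasurable]
      exact (variance_le_expectation_sq (hZL i).1).trans (hZ2 i)
    calc _ ≤ (N:ℝ)⁻¹ ^ 2 * ∑ i ∈ Finset.range N, C := by
          gcongr with i hi; exact this i hi
      _ = C / N := by simp; field_simp
  have := variance_eq_sub hYL
  rw [hYm] at this
  have e : P[Y ^ 2] = ∫ ω, Y ω ^ 2 ∂P := rfl
  rw [e] at this
  change ∫ ω, Y ω ^ 2 ∂P ≤ _
  linarith

/-- Uniform probability measure on `(t₀, T]`. -/
noncomputable def nuT (t₀ T : ℝ) : Measure ℝ :=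
  ENNReal.ofReal (T - t₀)⁻¹ • (volume.restrict (Set.Ioc t₀ T))

lemma nuT_prob (t₀ T : ℝ) (h : t₀ < T) : IsProbabilityMeasure (nuT t₀ T) := by
  constructor
  have : 0 < T - t₀ := sub_pos.2 h
  simp only [nuT, Measure.smul_apply, Measure.restrict_apply_univ, Real.volume_Ioc, smul_eq_mul]
  rw [← ENNReal.ofReal_mul (by positivity), inv_mul_cancel₀ this.ne', ENNReal.ofReal_one]

lemma nuT_integral (t₀ T : ℝ) (h : t₀ < T) (f : ℝ → ℝ) :
    ∫ s, f s ∂(nuT t₀ T) = (T - t₀)⁻¹ * ∫ s in t₀..T, f s := by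
  have : 0 < T - t₀ := sub_pos.2 h
  rw [nuT, integral_smul_measure, intervalIntegral.integral_of_le h.le,
    ENNReal.toReal_ofReal (by positivity), smul_eq_mul]

lemma nuT_ae (t₀ T : ℝ) : ∀ᵐ s ∂(nuT t₀ T), s ∈ Set.Icc t₀ T := by
  apply Measure.ae_smul_measure
  filter_upwards [ae_restrict_mem measurableSet_Ioc] with s hs
  exact Set.Ioc_subset_Icc_self hs

lemma law_eq {Ω : Type*} [MeasurableSpace Ω] (P : Measure Ω) [IsProbabilityMeasure P]
    (t₀ T t : ℝ) (htT : t₀ < T)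
    (X : Ω → ℝ → ℝ) (hX : Measurable (fun q : Ω × ℝ => X q.1 q.2))
    (pst : ℝ → ℝ → ℝ → ℝ)
    (hpstmeas : Measurable (fun q : ℝ × ℝ × ℝ => pst q.1 q.2.1 q.2.2))
    (hpstpos : ∀ s ξ ζ, 0 ≤ pst s ξ ζ)
    (hdensity : ∀ s ∈ Set.Icc t₀ T,
      P.map (fun ω => (X ω s, X ω (s + t))) =
        (volume : Measure (ℝ × ℝ)).withDensity
          (fun z => ENNReal.ofReal (pst s z.1 z.2)))
    (st : ℝ → ℝ → ℝ)
    (hst : ∀ ξ ζ, st ξ ζ = (T - t₀)⁻¹ * ∫ s in t₀..T, pst s ξ ζ) :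
    (P.prod (nuT t₀ T)).map (fun q : Ω × ℝ => (X q.1 q.2, X q.1 (q.2 + t))) =
      (volume : Measure (ℝ × ℝ)).withDensity (fun z => ENNReal.ofReal (st z.1 z.2)) := by
  have := nuT_prob t₀ T htT
  have hφ : Measurable (fun q : Ω × ℝ => (X q.1 q.2, X q.1 (q.2 + t))) :=
    hX.prodMk (hX.comp (measurable_fst.prodMk (measurable_snd.add_const t)))
  have hp2 : Measurable (fun q : ℝ × (ℝ × ℝ) => ENNReal.ofReal (pst q.1 q.2.1 q.2.2)) :=
    hpstmeas.ennreal_ofReal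
  have key : ∀ A : Set (ℝ × ℝ), MeasurableSet A →
      (P.prod (nuT t₀ T)).map (fun q : Ω × ℝ => (X q.1 q.2, X q.1 (q.2 + t))) A
        = ∫⁻ z in A, ∫⁻ s, ENNReal.ofReal (pst s z.1 z.2) ∂(nuT t₀ T) := by
    intro A hA
    rw [Measure.map_apply hφ hA, Measure.prod_apply_symm (hφ hA)]
    rw [lintegral_lintegral_swap
      (f := fun (z : ℝ × ℝ) (s : ℝ) => ENNReal.ofReal (pst s z.1 z.2))
      (hp2.comp measurable_swap).aemeasurable]
    apply lintegral_congr_ae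
    filter_upwards [nuT_ae t₀ T] with s hs
    rw [← withDensity_apply _ hA, ← hdensity s hs, Measure.map_apply _ hA]
    · rfl
    · exact hφ.comp (measurable_id.prodMk measurable_const)
  have hfin : ∀ᵐ z : ℝ × ℝ, ∫⁻ s, ENNReal.ofReal (pst s z.1 z.2) ∂(nuT t₀ T) < ⊤ := by
    apply ae_lt_top
    · exact Measurable.lintegral_prod_left' hp2
    · have := key Set.univ MeasurableSet.univ
      rw [Measure.restrict_univ] at this
      rw [← this]
      exact measure_ne_top _ _
  have heq : ∀ᵐ z : ℝ × ℝ, ∫⁻ s, ENNReal.ofReal (pst s z.1 z.2) ∂(nuT t₀ T)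
      = ENNReal.ofReal (st z.1 z.2) := by
    filter_upwards [hfin] with z hz
    have hm : Measurable (fun s => pst s z.1 z.2) :=
      hpstmeas.comp (measurable_id.prodMk measurable_const)
    rw [hst, ← nuT_integral t₀ T htT, ofReal_integral_eq_lintegral_ofReal]
    · exact (lintegral_ofReal_ne_top_iff_integrable hm.aestronglyMeasurable
        (Filter.Eventually.of_forall fun s => hpstpos _ _ _)).1 hz.ne
    · exact Filter.Eventually.of_forall fun s => hpstpos _ _ _
  ext A hA
  rw [key A hA, withDensity_apply _ hA]
  exact lintegral_congr_ae (ae_restrict_of_ae heq)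

lemma Kh_sq (K : ℝ → ℝ) (hKsq : MemLp K 2 (volume : Measure ℝ)) (h : ℝ) (hh : 0 < h) (x : ℝ) :
    Integrable (fun z => Kh K h (x - z) ^ 2) ∧
      ∫ z, Kh K h (x - z) ^ 2 = h⁻¹ * ∫ u, K u ^ 2 := by
  have e : (fun z => Kh K h (x - z) ^ 2) = fun z => (fun w => h⁻¹ ^ 2 * K (w / h) ^ 2) (x - z) := by
    funext z; simp only [Kh]; ring
  have hi : Integrable (fun w => h⁻¹ ^ 2 * K (w / h) ^ 2) :=
    (hKsq.integrable_sq.comp_div hh.ne').const_mul _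
  rw [e]
  refine ⟨hi.comp_sub_left x, ?_⟩
  rw [integral_sub_left_eq_self (fun w => h⁻¹ ^ 2 * K (w / h) ^ 2) volume x, integral_const_mul,
    Measure.integral_comp_div (fun w => K w ^ 2) h, abs_of_pos hh, smul_eq_mul]
  field_simp

lemma Q_sq (K : ℝ → ℝ) (hKsq : MemLp K 2 (volume : Measure ℝ)) (h₁ h₂ : ℝ) (hh₁ : 0 < h₁)
    (hh₂ : 0 < h₂) (x y : ℝ) :
    Integrable (fun z : ℝ × ℝ => Qker K h₁ h₂ (x - z.1) (y - z.2) ^ 2) ∧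
      ∫ z : ℝ × ℝ, Qker K h₁ h₂ (x - z.1) (y - z.2) ^ 2 = (∫ u, K u ^ 2) ^ 2 / (h₁ * h₂) := by
  have e : (fun z : ℝ × ℝ => Qker K h₁ h₂ (x - z.1) (y - z.2) ^ 2) =
      fun z => Kh K h₁ (x - z.1) ^ 2 * Kh K h₂ (y - z.2) ^ 2 := by
    funext z; simp only [Qker]; ring
  rw [e]
  obtain ⟨a1, a2⟩ := Kh_sq K hKsq h₁ hh₁ x
  obtain ⟨b1, b2⟩ := Kh_sq K hKsq h₂ hh₂ y
  refine ⟨a1.mul_prod b1, ?_⟩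
  rw [Measure.volume_eq_prod, integral_prod_mul (fun z => Kh K h₁ (x - z) ^ 2)
    (fun z => Kh K h₂ (y - z) ^ 2), a2, b2]
  field_simp

lemma Q_meas (K : ℝ → ℝ) (hK : Measurable K) (h₁ h₂ : ℝ) :
    Measurable (fun q : ℝ × ℝ => Qker K h₁ h₂ q.1 q.2) := by
  unfold Qker Kh
  fun_prop

lemma Q_L2 {B : Type*} [MeasurableSpace B] (R : Measure B) [IsProbabilityMeasure R]
    (K : ℝ → ℝ) (hK : Measurable K) (hKsq : MemLp K 2 (volume : Measure ℝ)) (h₁ h₂ : ℝ)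
    (hh₁ : 0 < h₁) (hh₂ : 0 < h₂) (φ : B → ℝ × ℝ) (hφ : Measurable φ) :
    MemLp (fun p : (ℝ × ℝ) × B => Qker K h₁ h₂ ((φ p.2).1 - p.1.1) ((φ p.2).2 - p.1.2)) 2
        ((volume : Measure (ℝ × ℝ)).prod R) ∧
      ∫ p : (ℝ × ℝ) × B, Qker K h₁ h₂ ((φ p.2).1 - p.1.1) ((φ p.2).2 - p.1.2) ^ 2
        ∂((volume : Measure (ℝ × ℝ)).prod R) = (∫ u, K u ^ 2) ^ 2 / (h₁ * h₂) := by
  have hm : Measurable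
      (fun p : (ℝ × ℝ) × B => Qker K h₁ h₂ ((φ p.2).1 - p.1.1) ((φ p.2).2 - p.1.2)) := by
    apply (Q_meas K hK h₁ h₂).comp
      (g := fun q : ℝ × ℝ => Qker K h₁ h₂ q.1 q.2)
      (f := fun p : (ℝ × ℝ) × B => ((φ p.2).1 - p.1.1, (φ p.2).2 - p.1.2))
    fun_prop
  have hi : Integrable (fun p : (ℝ × ℝ) × B =>
      Qker K h₁ h₂ ((φ p.2).1 - p.1.1) ((φ p.2).2 - p.1.2) ^ 2)
      ((volume : Measure (ℝ × ℝ)).prod R) := by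
    refine (integrable_prod_iff' (hm.pow_const 2).aestronglyMeasurable).2
      ⟨Filter.Eventually.of_forall fun b =>
        (Q_sq K hKsq h₁ h₂ hh₁ hh₂ (φ b).1 (φ b).2).1, ?_⟩
    have e : ∀ b : B, ∫ z : ℝ × ℝ, ‖Qker K h₁ h₂ ((φ b).1 - z.1) ((φ b).2 - z.2) ^ 2‖
        = (∫ u, K u ^ 2) ^ 2 / (h₁ * h₂) := by
      intro b
      rw [← (Q_sq K hKsq h₁ h₂ hh₁ hh₂ (φ b).1 (φ b).2).2]
      congr 1
      funext z
      exact Real.norm_of_nonneg (sq_nonneg _)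
    simp_rw [e]
    exact integrable_const _
  refine ⟨(memLp_two_iff_integrable_sq hm.aestronglyMeasurable).2 hi, ?_⟩
  rw [integral_prod_symm _ hi]
  have e : ∀ b : B, ∫ z : ℝ × ℝ, Qker K h₁ h₂ ((φ b).1 - z.1) ((φ b).2 - z.2) ^ 2
        = (∫ u, K u ^ 2) ^ 2 / (h₁ * h₂) := fun b =>
      (Q_sq K hKsq h₁ h₂ hh₁ hh₂ (φ b).1 (φ b).2).2
  simp_rw [e]
  rw [integral_const, probReal_univ, one_smul]

lemma Q_symm (K : ℝ → ℝ) (hKsym : ∀ x, K (-x) = K x) (h₁ h₂ a b c d : ℝ) :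
    Qker K h₁ h₂ (a - b) (c - d) = Qker K h₁ h₂ (b - a) (d - c) := by
  unfold Qker Kh
  rw [← hKsym ((a - b) / h₁), ← hKsym ((c - d) / h₂)]
  congr 3 <;> ring

lemma wt_int (δ : ℝ → ℝ) (hδmeas : Measurable δ) (hδnonneg : ∀ y, 0 ≤ δ y)
    (M : ℝ) (hδle : ∀ y, δ y ≤ M) {E : Type*} [MeasurableSpace E] (R : Measure E)
    (f : E → ℝ) (d : E → ℝ × ℝ) (hd : Measurable d) (hf : Integrable f R) :
    Integrable (fun e => f e * δ (d e).2) R := by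
  refine hf.mul_bdd (c := M) (hδmeas.comp (measurable_snd.comp hd)).aestronglyMeasurable ?_
  exact Filter.Eventually.of_forall fun e => by
    simpa [abs_of_nonneg (hδnonneg _)] using hδle _

set_option maxHeartbeats 1000000 in
/-- Proposition 3.1, second (weighted) inequality.
`E(‖ŝ_{𝐡,t} − s_t‖²_{1⊗δ}) ≤ ‖Q_𝐡 ⋆ s_t − s_t‖²_{1⊗δ} + M‖K‖⁴/(N h₁ h₂)`,
for any bounded nonnegative measurable weight `δ ≤ M`. -/
theorem risk_bound_numerator_NW_weighted
    {Ω : Type*} [MeasurableSpace Ω] (P : Measure Ω) [IsProbabilityMeasure P]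
    (K : ℝ → ℝ) (hKmeas : Measurable K)
    (hKsq : MemLp K 2 (volume : Measure ℝ))
    (hKsym : ∀ x, K (-x) = K x)
    (hKint : Integrable K (volume : Measure ℝ)) (hKone : ∫ x, K x = 1)
    (t₀ T t : ℝ) (ht₀ : 0 ≤ t₀) (htT : t₀ < T) (ht : t ∈ Set.Ioc 0 T)
    (N : ℕ) (hN : 0 < N)
    (X : ℕ → Ω → ℝ → ℝ)
    (hXmeas : ∀ i, Measurable (fun q : Ω × ℝ => X i q.1 q.2))
    (hindep : iIndepFun (m := fun _ : ℕ => (inferInstance : MeasurableSpace (ℝ → ℝ)))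
      (fun i ω => X i ω) P)
    (pst : ℝ → ℝ → ℝ → ℝ)
    (hpstmeas : Measurable (fun q : ℝ × ℝ × ℝ => pst q.1 q.2.1 q.2.2))
    (hpstpos : ∀ s ξ ζ, 0 ≤ pst s ξ ζ)
    (hdensity : ∀ i, ∀ s ∈ Set.Icc t₀ T,
      P.map (fun ω => (X i ω s, X i ω (s + t))) =
        (volume : Measure (ℝ × ℝ)).withDensity
          (fun z => ENNReal.ofReal (pst s z.1 z.2)))
    (st : ℝ → ℝ → ℝ)
    (hst : ∀ ξ ζ, st ξ ζ = (T - t₀)⁻¹ * ∫ s in t₀..T, pst s ξ ζ)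
    (hstL2 : MemLp (fun z : ℝ × ℝ => st z.1 z.2) 2 (volume : Measure (ℝ × ℝ)))
    (δ : ℝ → ℝ) (hδmeas : Measurable δ) (hδnonneg : ∀ y, 0 ≤ δ y)
    (M : ℝ) (hM : 0 < M) (hδle : ∀ y, δ y ≤ M)
    (h₁ h₂ : ℝ) (hh₁ : h₁ ∈ Set.Ioc (0 : ℝ) 1) (hh₂ : h₂ ∈ Set.Ioc (0 : ℝ) 1) :
    ∫ ω, (∫ z : ℝ × ℝ,
        (((N : ℝ) * (T - t₀))⁻¹ * (∑ i ∈ Finset.range N,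
            ∫ s in t₀..T, Qker K h₁ h₂ (X i ω s - z.1) (X i ω (s + t) - z.2))
          - st z.1 z.2) ^ 2 * δ z.2) ∂P
      ≤ (∫ z : ℝ × ℝ,
          ((∫ w : ℝ × ℝ, Qker K h₁ h₂ (z.1 - w.1) (z.2 - w.2) * st w.1 w.2)
            - st z.1 z.2) ^ 2 * δ z.2)
        + M * (∫ x, K x ^ 2) ^ 2 / ((N : ℝ) * h₁ * h₂) := by
  obtain ⟨hh₁, -⟩ := hh₁
  obtain ⟨hh₂, -⟩ := hh₂
  have hTt : 0 < T - t₀ := sub_pos.2 htT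
  have hN' : (0:ℝ) < N := by exact_mod_cast hN
  have hνp := nuT_prob t₀ T htT
  set ν := nuT t₀ T with hν
  set φ : ℕ → Ω × ℝ → ℝ × ℝ := fun i q => (X i q.1 q.2, X i q.1 (q.2 + t)) with hφdef
  have hφ : ∀ i, Measurable (φ i) := fun i =>
    (hXmeas i).prodMk ((hXmeas i).comp (measurable_fst.prodMk (measurable_snd.add_const t)))
  set L : Measure (ℝ × ℝ) := (volume : Measure (ℝ × ℝ)).withDensity
    (fun z => ENNReal.ofReal (st z.1 z.2)) with hL
  have hlaw : ∀ i, (P.prod ν).map (φ i) = L := fun i =>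
    law_eq P t₀ T t htT (X i) (hXmeas i) pst hpstmeas hpstpos (hdensity i) st hst
  have hLp : IsProbabilityMeasure L := by
    rw [← hlaw 0]; exact Measure.isProbabilityMeasure_map (hφ 0).aemeasurable
  have hst0 : ∀ z : ℝ × ℝ, 0 ≤ st z.1 z.2 := fun z => by
    rw [hst]
    exact mul_nonneg (by positivity)
      (intervalIntegral.integral_nonneg htT.le fun s _ => hpstpos _ _ _)
  set g : ℝ × ℝ → ℝ × ℝ → ℝ := fun z w => Qker K h₁ h₂ (w.1 - z.1) (w.2 - z.2) with hg
  have hgm : ∀ z, Measurable (g z) := fun z => by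
    apply (Q_meas K hKmeas h₁ h₂).comp
      (g := fun q : ℝ × ℝ => Qker K h₁ h₂ q.1 q.2)
      (f := fun p : (ℝ × ℝ) => (p.1 - z.1, p.2 - z.2))
    fun_prop
  set V : ℝ := (∫ u, K u ^ 2) ^ 2 / (h₁ * h₂) with hV
  have hLL := Q_L2 L K hKmeas hKsq h₁ h₂ hh₁ hh₂ id measurable_id
  have hGL := fun i => (Q_L2 (P.prod ν) K hKmeas hKsq h₁ h₂ hh₁ hh₂ (φ i) (hφ i)).1
  -- bias function
  set m : ℝ × ℝ → ℝ := fun z => ∫ w : ℝ × ℝ, Qker K h₁ h₂ (z.1 - w.1) (z.2 - w.2) * st w.1 w.2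
    with hm
  have hmL : ∀ z, m z = ∫ w, g z w ∂L := by
    intro z
    rw [hL, integral_withDensity_eq_integral_toReal_smul₀
      hstL2.1.aemeasurable.ennreal_ofReal
      (Filter.Eventually.of_forall fun _ => ENNReal.ofReal_lt_top)]
    refine integral_congr_ae (Filter.Eventually.of_forall fun w => ?_)
    simp only [ENNReal.toReal_ofReal (hst0 w), smul_eq_mul, hg]
    rw [Q_symm K hKsym, mul_comm]
  have hm2 : MemLp m 2 (volume : Measure (ℝ × ℝ)) := by
    have := (lemB volume L _ hLL.1).1
    rw [show m = _ from funext hmL]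
    exact this
  set c : ℝ × ℝ → ℝ := fun z => ∫ w, g z w ^ 2 ∂L with hc
  have hci : Integrable c (volume : Measure (ℝ × ℝ)) := hLL.1.integrable_sq.integral_prod_left
  have hcV : ∫ z, c z = V := by
    rw [hV, ← hLL.2, integral_prod _ hLL.1.integrable_sq]; rfl
  have hc0 : ∀ z, 0 ≤ c z := fun z => integral_nonneg fun w => sq_nonneg _
  -- the estimator
  set Y : Ω → ℝ × ℝ → ℝ := fun ω z =>
    (N : ℝ)⁻¹ * (∑ i ∈ Finset.range N, ∫ s, g z (φ i (ω, s)) ∂ν) - st z.1 z.2 with hY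
  have hLHS : ∀ ω (z : ℝ × ℝ), (((N : ℝ) * (T - t₀))⁻¹ * (∑ i ∈ Finset.range N,
            ∫ s in t₀..T, Qker K h₁ h₂ (X i ω s - z.1) (X i ω (s + t) - z.2))
          - st z.1 z.2) = Y ω z := by
    intro ω z
    simp only [hY, hν, nuT_integral t₀ T htT, ← Finset.mul_sum, mul_inv, mul_assoc, hg, hφdef]
  simp_rw [hLHS]
  have hpt : ∀ᵐ z : ℝ × ℝ, ∫ ω, Y ω z ^ 2 ∂P ≤ (m z - st z.1 z.2) ^ 2 + c z / N := by
    have hae : ∀ᵐ z : ℝ × ℝ, ∀ i, Integrable (fun q => g z (φ i q) ^ 2) (P.prod ν) :=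
      ae_all_iff.2 fun i => (hGL i).integrable_sq.prod_right_ae
    filter_upwards [hae] with z hz
    refine lemA P ν N hN (fun i q => g z (φ i q)) (fun i => (hgm z).comp (hφ i))
      (fun i => (memLp_two_iff_integrable_sq ((hgm z).comp (hφ i)).aestronglyMeasurable).2 (hz i))
      (m z) ?_ ?_ (c z) ?_ (st z.1 z.2)
    · intro i
      rw [hmL, ← hlaw i, integral_map (hφ i).aemeasurable (hgm z).aestronglyMeasurable]
    · intro i j hij s u
      have ψ : ∀ s : ℝ, Measurable (fun f : ℝ → ℝ => g z (f s, f (s + t))) := fun s =>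
        (hgm z).comp ((measurable_pi_apply s).prodMk (measurable_pi_apply (s + t)))
      exact (hindep.indepFun hij).comp (ψ s) (ψ u)
    · intro i
      rw [hc, ← hlaw i]
      simp only
      rw [integral_map (hφ i).aemeasurable ((hgm z).pow_const 2).aestronglyMeasurable]
  have hYL : MemLp (fun p : Ω × (ℝ × ℝ) => Y p.1 p.2) 2 (P.prod volume) := by
    have mp : MeasurePreserving (fun q : (Ω × (ℝ × ℝ)) × ℝ => (q.1.2, (q.1.1, q.2)))
        ((P.prod (volume : Measure (ℝ × ℝ))).prod ν)
        ((volume : Measure (ℝ × ℝ)).prod (P.prod ν)) :=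
      (measurePreserving_prodAssoc _ _ _).comp
        (Measure.measurePreserving_swap.prod (MeasurePreserving.id ν))
    have hi : ∀ i, MemLp (fun p : Ω × (ℝ × ℝ) => ∫ s, g p.2 (φ i (p.1, s)) ∂ν) 2
        (P.prod (volume : Measure (ℝ × ℝ))) := fun i =>
      (lemB (P.prod volume) ν _ ((hGL i).comp_measurePreserving mp)).1
    have hs : MemLp (fun p : Ω × (ℝ × ℝ) =>
        ∑ i ∈ Finset.range N, ∫ s, g p.2 (φ i (p.1, s)) ∂ν) 2
        (P.prod (volume : Measure (ℝ × ℝ))) :=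
      memLp_finsetSum (Finset.range N)
        (f := fun i (p : Ω × (ℝ × ℝ)) => ∫ s, g p.2 (φ i (p.1, s)) ∂ν) fun i _ => hi i
    have hs2 := hs.const_mul (N : ℝ)⁻¹
    have hs3 : MemLp (fun p : Ω × (ℝ × ℝ) => st p.2.1 p.2.2) 2
        (P.prod (volume : Measure (ℝ × ℝ))) := hstL2.comp_snd P
    exact hs2.sub hs3
  have hF : Integrable (fun p : Ω × (ℝ × ℝ) => Y p.1 p.2 ^ 2 * δ p.2.2) (P.prod volume) :=
    wt_int δ hδmeas hδnonneg M hδle _ _ Prod.snd measurable_snd hYL.integrable_sq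
  have hbias : Integrable (fun z : ℝ × ℝ => (m z - st z.1 z.2) ^ 2 * δ z.2) :=
    wt_int δ hδmeas hδnonneg M hδle _ _ id measurable_id (hm2.sub hstL2).integrable_sq
  have hvar : Integrable (fun z : ℝ × ℝ => M * (c z / N)) := (hci.div_const _).const_mul _
  rw [integral_integral_swap hF]
  calc ∫ z : ℝ × ℝ, ∫ ω, Y ω z ^ 2 * δ z.2 ∂P
      ≤ ∫ z : ℝ × ℝ, ((m z - st z.1 z.2) ^ 2 * δ z.2 + M * (c z / N)) := by
        refine integral_mono_ae hF.integral_prod_right (hbias.add hvar) ?_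
        filter_upwards [hpt] with z hz
        simp only [integral_mul_const]
        have h1 := mul_le_mul_of_nonneg_right hz (hδnonneg z.2)
        have h2 : c z / N * δ z.2 ≤ c z / N * M :=
          mul_le_mul_of_nonneg_left (hδle _) (div_nonneg (hc0 z) hN'.le)
        linarith
    _ = _ := by
        rw [integral_add hbias hvar, integral_const_mul, integral_div, hcV, hV]
        congr 1
        field_simp
end

section
/- Let 0 < t₀ ≤ T, let c₁, m₁, r > 0, and let p : [t₀,T] × ℝ² → ℝ, (t,x,y) ↦ p_t(x,y), be continuously differentiable in (x,y) with |∂_x p_t(x,y)| + |∂_y p_t(x,y)| ≤ c₁ t^{−r} exp(−m₁(y−x)²/t) for all t ∈ [t₀,T] and (x,y) ∈ ℝ². Let δ be a probability density on ℝ and set c₂ := 2∫₀^∞ exp(−2m₁ y²/T) dy. Then for every t ∈ [t₀,T] and every θ ∈ ℝ: ∫_ℝ ‖p_t(·, y+θ) − p_t(·, y)‖²_δ dy ≤ (c₁²/t₀^{2r})(c₂ θ² + |θ|³), and ∫_ℝ ‖p_t(x+θ, ·) − p_t(x, ·)‖²_δ dx ≤ (c₁²/t₀^{2r})(c₂ θ²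 + |θ|³). (Lemma A.1, Nikolskii-type condition, with explicit constants from its proof.) -/
open MeasureTheory Real

lemma nik_g (m T a b : ℝ) (hm : 0 < m) (hT : 0 < T) (hab : a ≤ b) :
    ∃ g : ℝ → ℝ, Measurable g ∧ (∀ u, 0 ≤ g u) ∧
      (∀ u, b < u → exp (-2 * m * (u - b) ^ 2 / T) ≤ g u) ∧
      (∀ u, u < a → exp (-2 * m * (a - u) ^ 2 / T) ≤ g u) ∧
      (∀ u, a ≤ u → u ≤ b → 1 ≤ g u) ∧
      ∫⁻ u, ENNReal.ofReal (g u) =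
        ENNReal.ofReal ((2 * ∫ y in Set.Ioi (0 : ℝ), exp (-2 * m * y ^ 2 / T)) + (b - a)) := by
  set E : ℝ → ℝ := fun y => exp (-2 * m * y ^ 2 / T) with hE
  have hEm : Measurable E := by fun_prop
  have hEi : Integrable E := by
    have := integrable_exp_neg_mul_sq (b := 2 * m / T) (by positivity)
    convert this using 3
    ring
  set A : ℝ → ℝ := (Set.Ioi (0:ℝ)).indicator E with hA
  set B : ℝ → ℝ := (Set.Icc a b).indicator (fun _ => (1:ℝ)) with hB
  have hAm : Measurable A := hEm.indicator measurableSet_Ioi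
  have hBm : Measurable B := measurable_const.indicator measurableSet_Icc
  have hAi : Integrable A := hEi.indicator measurableSet_Ioi
  have hBi : Integrable B := by
    rw [hB, integrable_indicator_iff measurableSet_Icc]
    exact integrableOn_const (by simp)
  have hA0 : ∀ u, 0 ≤ A u := fun u => Set.indicator_nonneg (fun _ _ => (exp_pos _).le) u
  have hB0 : ∀ u, 0 ≤ B u := fun u => Set.indicator_nonneg (fun _ _ => zero_le_one) u
  have i1 : Integrable (fun u => A (u - b)) := hAi.comp_sub_right b
  have i2 : Integrable (fun u => A (a - u)) := hAi.comp_sub_left a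
  refine ⟨fun u => A (u - b) + A (a - u) + B u, by fun_prop, ?_, ?_, ?_, ?_, ?_⟩
  · intro u
    have := hA0 (u - b); have := hA0 (a - u); have := hB0 u
    positivity
  · intro u hu
    have h1 : A (u - b) = E (u - b) := Set.indicator_of_mem (by simpa using hu) _
    have := hA0 (a - u); have := hB0 u
    show E (u - b) ≤ _
    linarith
  · intro u hu
    have h1 : A (a - u) = E (a - u) := Set.indicator_of_mem (by simpa using hu) _
    have := hA0 (u - b); have := hB0 u
    show E (a - u) ≤ _
    linarith
  · intro u hu hu'
    have h1 : B u = 1 := Set.indicator_of_mem (show u ∈ Set.Icc a b from ⟨hu, hu'⟩) _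
    have := hA0 (u - b); have := hA0 (a - u)
    show 1 ≤ A (u - b) + A (a - u) + B u
    linarith
  · have i3 : Integrable (fun u => A (u - b) + A (a - u) + B u) := (i1.add i2).add hBi
    rw [← ofReal_integral_eq_lintegral_ofReal i3]
    · congr 1
      have e1 : ∫ u, A (u - b) = ∫ u, A u := integral_sub_right_eq_self A b
      have e2 : ∫ u, A (a - u) = ∫ u, A u := integral_sub_left_eq_self A volume a
      have e3 : ∫ u, A u = ∫ y in Set.Ioi (0:ℝ), E y := integral_indicator measurableSet_Ioi
      have e4 : ∫ u, B u = b - a := by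
        rw [hB, integral_indicator measurableSet_Icc]
        simp [hab]
      have : ∫ u, (A (u - b) + A (a - u) + B u) =
          (∫ u, A (u - b)) + (∫ u, A (a - u)) + ∫ u, B u := by
        have i4 : Integrable (fun u => A (u - b) + A (a - u)) := i1.add i2
        rw [integral_add i4 hBi, integral_add i1 i2]
      rw [this, e1, e2, e3, e4]
      ring
    · filter_upwards with u
      have := hA0 (u - b); have := hA0 (a - u); have := hB0 u
      show 0 ≤ A (u - b) + A (a - u) + B u
      positivity

lemma nik_half (t T K m θ : ℝ) (ht : 0 < t) (htT : t ≤ T) (hK : 0 ≤ K) (hm : 0 < m)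
    (F : ℝ → ℝ → ℝ) (hd : ∀ x, Differentiable ℝ (F x))
    (hF : ∀ x y, |deriv (F x) y| ≤ K * exp (-m * (y - x) ^ 2 / t))
    (δ : ℝ → ℝ) (hδmeas : Measurable δ) (hδnonneg : ∀ x, 0 ≤ δ x)
    (hδint : ∫ x, δ x = 1) :
    (∫ y, ∫ x, (F x (y + θ) - F x y) ^ 2 * δ x)
      ≤ K ^ 2 * ((2 * ∫ y in Set.Ioi (0 : ℝ), exp (-2 * m * y ^ 2 / T)) * θ ^ 2 + |θ| ^ 3) := by
  have hT : 0 < T := ht.trans_le htT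
  have hab : min 0 (-θ) ≤ max 0 (-θ) := min_le_max
  obtain ⟨g, gm, g0, g1, g2, g3, gI⟩ := nik_g m T (min 0 (-θ)) (max 0 (-θ)) hm hT hab
  have hsub : max 0 (-θ) - min 0 (-θ) = |θ| := by
    rw [max_sub_min_eq_abs]; simp
  rw [hsub] at gI
  have mv : ∀ x y C, (∀ s ∈ Set.uIcc y (y + θ), exp (-m * (s - x) ^ 2 / t) ≤ C) →
      (F x (y + θ) - F x y) ^ 2 ≤ K ^ 2 * θ ^ 2 * C ^ 2 := by
    intro x y C hC
    have h := Convex.norm_image_sub_le_of_norm_deriv_le (𝕜 := ℝ) (f := F x) (C := K * C)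
      (s := Set.uIcc y (y + θ)) (x := y) (y := y + θ)
      (fun s _ => hd x s) (fun s hs => by
        rw [Real.norm_eq_abs]
        exact (hF x s).trans (mul_le_mul_of_nonneg_left (hC s hs) hK))
      (convex_uIcc _ _) Set.left_mem_uIcc Set.right_mem_uIcc
    rw [Real.norm_eq_abs, Real.norm_eq_abs, add_sub_cancel_left] at h
    have h2 := pow_le_pow_left₀ (abs_nonneg _) h 2
    rw [sq_abs, mul_pow, sq_abs] at h2
    linarith
  have expb : ∀ w v : ℝ, w ^ 2 ≤ v ^ 2 → exp (-m * v ^ 2 / t) ≤ exp (-m * w ^ 2 / T) := by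
    intro w v h
    apply exp_le_exp.2
    have : m * w ^ 2 / T ≤ m * v ^ 2 / t := by gcongr
    rw [neg_mul, neg_mul, neg_div, neg_div]
    linarith
  have expsq : ∀ w : ℝ, exp (-m * w ^ 2 / T) ^ 2 = exp (-2 * m * w ^ 2 / T) := by
    intro w
    rw [← exp_nat_mul]; congr 1; push_cast; ring
  have key : ∀ x y, (F x (y + θ) - F x y) ^ 2 ≤ K ^ 2 * θ ^ 2 * g (y - x) := by
    intro x y
    have hKθ : 0 ≤ K ^ 2 * θ ^ 2 := by positivity
    have lo : ∀ s ∈ Set.uIcc y (y + θ), y - x - max 0 (-θ) ≤ s - x := by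
      intro s hs
      have := hs.1
      rcases le_total 0 θ with h | h
      · have h1 : min y (y + θ) = y := min_eq_left (by linarith)
        have := le_max_left 0 (-θ)
        simp only [h1] at *; linarith
      · have h1 : min y (y + θ) = y + θ := min_eq_right (by linarith)
        have := le_max_right 0 (-θ)
        simp only [h1] at *; linarith
    have hi : ∀ s ∈ Set.uIcc y (y + θ), s - x ≤ y - x - min 0 (-θ) := by
      intro s hs
      have := hs.2
      rcases le_total 0 θ with h | h
      · have h1 : max y (y + θ) = y + θ := max_eq_right (by linarith)
        have := min_le_right 0 (-θ)
        simp only [h1] at *; linarith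
      · have h1 : max y (y + θ) = y := max_eq_left (by linarith)
        have := min_le_left 0 (-θ)
        simp only [h1] at *; linarith
    by_cases h1 : max 0 (-θ) < y - x
    · refine (mv x y (exp (-m * (y - x - max 0 (-θ)) ^ 2 / T)) ?_).trans ?_
      · intro s hs
        apply expb
        have := lo s hs
        apply pow_le_pow_left₀ (by linarith) this
      · rw [expsq]
        exact mul_le_mul_of_nonneg_left (g1 _ h1) hKθ
    by_cases h2 : y - x < min 0 (-θ)
    · refine (mv x y (exp (-m * (min 0 (-θ) - (y - x)) ^ 2 / T)) ?_).trans ?_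
      · intro s hs
        apply expb
        have := hi s hs
        rw [← neg_sq (s - x)]
        apply pow_le_pow_left₀ (by linarith)
        linarith
      · rw [expsq]
        exact mul_le_mul_of_nonneg_left (g2 _ h2) hKθ
    · refine (mv x y 1 ?_).trans ?_
      · intro s hs
        apply exp_le_one_iff.2
        have : 0 ≤ m * (s - x) ^ 2 / t := by positivity
        rw [neg_mul, neg_div]; linarith
      · rw [one_pow]
        exact mul_le_mul_of_nonneg_left (g3 _ (not_lt.1 h2) (not_lt.1 h1)) hKθ
  have hδi : Integrable δ := by
    by_contra h
    rw [integral_undef h] at hδint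
    norm_num at hδint
  have hδl : ∫⁻ x, ENNReal.ofReal (δ x) = 1 := by
    rw [← ofReal_integral_eq_lintegral_ofReal hδi (Filter.Eventually.of_forall hδnonneg), hδint]
    simp
  have hI0 : 0 ≤ ∫ y in Set.Ioi (0 : ℝ), exp (-2 * m * y ^ 2 / T) :=
    integral_nonneg fun _ => (exp_pos _).le
  have hR : 0 ≤ K ^ 2 * ((2 * ∫ y in Set.Ioi (0 : ℝ), exp (-2 * m * y ^ 2 / T)) * θ ^ 2
      + |θ| ^ 3) := by positivity
  set I := ∫ y in Set.Ioi (0 : ℝ), exp (-2 * m * y ^ 2 / T) with hI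
  have hKθ : 0 ≤ K ^ 2 * θ ^ 2 := by positivity
  rw [← ENNReal.ofReal_le_ofReal_iff hR]
  have hL : 0 ≤ ∫ y, ∫ x, (F x (y + θ) - F x y) ^ 2 * δ x :=
    integral_nonneg fun y => integral_nonneg fun x => mul_nonneg (sq_nonneg _) (hδnonneg x)
  rw [← Real.enorm_of_nonneg hL]
  calc ‖∫ y, ∫ x, (F x (y + θ) - F x y) ^ 2 * δ x‖ₑ
      ≤ ∫⁻ y, ‖∫ x, (F x (y + θ) - F x y) ^ 2 * δ x‖ₑ := enorm_integral_le_lintegral_enorm _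
    _ ≤ ∫⁻ y, ∫⁻ x, ‖(F x (y + θ) - F x y) ^ 2 * δ x‖ₑ :=
        lintegral_mono fun y => enorm_integral_le_lintegral_enorm _
    _ ≤ ∫⁻ y, ∫⁻ x, ENNReal.ofReal (K ^ 2 * θ ^ 2) *
          (ENNReal.ofReal (δ x) * ENNReal.ofReal (g (y - x))) := by
        refine lintegral_mono fun y => lintegral_mono fun x => ?_
        rw [Real.enorm_of_nonneg (mul_nonneg (sq_nonneg _) (hδnonneg x)),
          ← ENNReal.ofReal_mul (hδnonneg x), ← ENNReal.ofReal_mul hKθ]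
        apply ENNReal.ofReal_le_ofReal
        have := mul_le_mul_of_nonneg_right (key x y) (hδnonneg x)
        linarith
    _ = ∫⁻ x, ∫⁻ y, ENNReal.ofReal (K ^ 2 * θ ^ 2) *
          (ENNReal.ofReal (δ x) * ENNReal.ofReal (g (y - x))) := by
        apply lintegral_lintegral_swap
        apply Measurable.aemeasurable
        simp only [Function.uncurry_def]
        fun_prop
    _ = ∫⁻ x, ENNReal.ofReal (K ^ 2 * θ ^ 2) *
          (ENNReal.ofReal (δ x) * ENNReal.ofReal (2 * I + |θ|)) := by
        refine lintegral_congr fun x => ?_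
        rw [lintegral_const_mul _ (by fun_prop), lintegral_const_mul _ (by fun_prop),
          lintegral_sub_right_eq_self (fun u => ENNReal.ofReal (g u)) x, gI]
    _ = ENNReal.ofReal (K ^ 2 * θ ^ 2) * ENNReal.ofReal (2 * I + |θ|) := by
        rw [lintegral_const_mul _ (by fun_prop), lintegral_mul_const _ (by fun_prop), hδl, one_mul]
    _ = ENNReal.ofReal (K ^ 2 * (2 * I * θ ^ 2 + |θ| ^ 3)) := by
        rw [← ENNReal.ofReal_mul hKθ]
        congr 1
        have : |θ| ^ 3 = θ ^ 2 * |θ| := by rw [← sq_abs θ]; ring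
        rw [this]; ring
    _ ≤ _ := le_rfl

/-- Lemma A.1, Nikolskii-type condition with explicit constants.
Under the Kusuoka–Stroock gradient bound, for every `t ∈ [t₀,T]` and `θ ∈ ℝ`,
`∫ ‖p_t(·,y+θ) − p_t(·,y)‖²_δ dy ≤ (c₁²/t₀^{2r})(c₂θ² + |θ|³)` and similarly in
the first variable, where `c₂ = 2∫₀^∞ exp(−2m₁y²/T)dy`. -/
theorem Nikolskii_type_condition
    (t₀ T : ℝ) (ht₀ : 0 < t₀) (ht₀T : t₀ ≤ T)
    (c₁ m₁ r : ℝ) (hc₁ : 0 < c₁) (hm₁ : 0 < m₁) (hr : 0 < r)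
    (p : ℝ → ℝ → ℝ → ℝ)
    (hpC1 : ∀ t ∈ Set.Icc t₀ T, ContDiff ℝ 1 (fun z : ℝ × ℝ => p t z.1 z.2))
    (hpderiv : ∀ t ∈ Set.Icc t₀ T, ∀ x y : ℝ,
      |deriv (fun u => p t u y) x| + |deriv (fun v => p t x v) y|
        ≤ c₁ * t ^ (-r) * exp (-m₁ * (y - x) ^ 2 / t))
    (δ : ℝ → ℝ) (hδmeas : Measurable δ) (hδnonneg : ∀ x, 0 ≤ δ x)
    (hδint : ∫ x, δ x = 1) :
    ∀ t ∈ Set.Icc t₀ T, ∀ θ : ℝ,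
      (∫ y, ∫ x, (p t x (y + θ) - p t x y) ^ 2 * δ x)
        ≤ c₁ ^ 2 / t₀ ^ (2 * r) *
            ((2 * ∫ y in Set.Ioi (0 : ℝ), exp (-2 * m₁ * y ^ 2 / T)) * θ ^ 2 + |θ| ^ 3)
      ∧ (∫ x, ∫ y, (p t (x + θ) y - p t x y) ^ 2 * δ y)
        ≤ c₁ ^ 2 / t₀ ^ (2 * r) *
            ((2 * ∫ y in Set.Ioi (0 : ℝ), exp (-2 * m₁ * y ^ 2 / T)) * θ ^ 2 + |θ| ^ 3) := by
  intro t ht θ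
  have ht0 : 0 < t := ht₀.trans_le ht.1
  have hK : 0 ≤ c₁ * t ^ (-r) := by positivity
  have hKK : (c₁ * t ^ (-r)) ^ 2 ≤ c₁ ^ 2 / t₀ ^ (2 * r) := by
    rw [mul_pow, div_eq_mul_inv, ← Real.rpow_natCast (t ^ (-r)), ← Real.rpow_mul ht0.le,
      ← Real.rpow_neg ht₀.le]
    apply mul_le_mul_of_nonneg_left _ (sq_nonneg _)
    have : -r * ((2 : ℕ) : ℝ) = -(2 * r) := by push_cast; ring
    rw [this]
    exact Real.rpow_le_rpow_of_nonpos ht₀ ht.1 (by linarith)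
  have hI0 : 0 ≤ ∫ y in Set.Ioi (0 : ℝ), exp (-2 * m₁ * y ^ 2 / T) :=
    integral_nonneg fun _ => (exp_pos _).le
  have hR : 0 ≤ (2 * ∫ y in Set.Ioi (0 : ℝ), exp (-2 * m₁ * y ^ 2 / T)) * θ ^ 2
      + |θ| ^ 3 := by positivity
  have hdiff := (hpC1 t ht).differentiable one_ne_zero
  have hfin := mul_le_mul_of_nonneg_right hKK hR
  constructor
  · refine (nik_half t T _ m₁ θ ht0 ht.2 hK hm₁ (fun x y => p t x y) ?_ ?_
      δ hδmeas hδnonneg hδint).trans hfin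
    · intro x
      exact hdiff.comp (g := fun z : ℝ × ℝ => p t z.1 z.2) (f := fun y => (x, y)) (by fun_prop)
    · intro x y
      have := hpderiv t ht x y
      have := abs_nonneg (deriv (fun u => p t u y) x)
      linarith
  · refine (nik_half t T _ m₁ θ ht0 ht.2 hK hm₁ (fun y x => p t x y) ?_ ?_
      δ hδmeas hδnonneg hδint).trans hfin
    · intro y
      exact hdiff.comp (g := fun z : ℝ × ℝ => p t z.1 z.2) (f := fun x => (x, y)) (by fun_prop)
    · intro y x
      have := hpderiv t ht x y
      have := abs_nonneg (deriv (fun v => p t x v) y)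
      rw [show (x - y) ^ 2 = (y - x) ^ 2 by ring]
      linarith
end

section
/- Assume K ∈ L¹(ℝ) ∩ L²(ℝ) and ‖s_t‖_∞ ≤ c₁ for some c₁ > 0. Let X¹, X², X be independent copies of the process (with continuous sample paths). Then for all 𝐡, 𝐥 ∈ (0,1]², E(⟨Φ_{𝐡,t}(X¹;·), Φ_{𝐥,t}(X²;·)⟩²) ≤ c₁ ‖K‖₁⁴ · E(‖Φ_{𝐥,t}(X;·)‖²), where ⟨·,·⟩ and ‖·‖ are the L²(ℝ²) inner product and norm and ‖K‖₁ is the L¹(ℝ)-norm of K. (Proposition A.2, property (2).) -/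
open MeasureTheory ProbabilityTheory Real

/-- `Φ_{𝐡,t}(φ; x,y) = (T−t₀)⁻¹ ∫_{t₀}^T Q_𝐡(φ(s)−x, φ(s+t)−y) ds`. -/
noncomputable def PhiMap (K : ℝ → ℝ) (t₀ T t h₁ h₂ : ℝ) (φ : ℝ → ℝ) (z : ℝ × ℝ) : ℝ :=
  (T - t₀)⁻¹ * ∫ s in t₀..T, Qker K h₁ h₂ (φ s - z.1) (φ (s + t) - z.2)

lemma aux_cs {α : Type*} [MeasurableSpace α] (μ : Measure α) {f g : α → ENNReal}
    (hf : Measurable f) (hg : Measurable g) :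
    (∫⁻ a, f a * g a ∂μ) ^ 2 ≤ (∫⁻ a, f a ∂μ) * ∫⁻ a, f a * g a ^ 2 ∂μ := by
  have h := ENNReal.lintegral_mul_le_Lp_mul_Lq μ (p := 2) (q := 2) Real.HolderConjugate.two_two
    (f := fun a => f a ^ (1/2 : ℝ)) (g := fun a => f a ^ (1/2 : ℝ) * g a)
    (hf.pow_const _).aemeasurable ((hf.pow_const _).mul hg).aemeasurable
  have hh : ∀ x : ENNReal, x ^ (1/2 : ℝ) * x ^ (1/2 : ℝ) = x := by
    intro x
    rw [← ENNReal.rpow_add_of_nonneg _ _ (by norm_num) (by norm_num)]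
    norm_num
  have hsq : ∀ x : ENNReal, (x ^ (1/2 : ℝ)) ^ 2 = x := by
    intro x
    rw [pow_two, hh]
  have e1 : ∀ a, ((fun a => f a ^ (1/2 : ℝ)) * (fun a => f a ^ (1/2 : ℝ) * g a)) a = f a * g a := by
    intro a
    simp only [Pi.mul_apply]
    rw [← mul_assoc, hh]
  simp only [e1, ENNReal.rpow_two, mul_pow, hsq] at h
  calc _ ≤ _ := pow_le_pow_left₀ (by positivity) h 2
    _ = _ := by rw [mul_pow, hsq, hsq]

lemma Kh_measurable {K : ℝ → ℝ} (hK : Measurable K) (h : ℝ) : Measurable (Kh K h) := by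
  unfold Kh; fun_prop

lemma Kh_int {K : ℝ → ℝ} (hK : Integrable K) {h : ℝ} (hh : 0 < h) : Integrable (Kh K h) := by
  unfold Kh; exact (hK.comp_div hh.ne').const_mul _

lemma Kh_l1 {K : ℝ → ℝ} (hK : Integrable K) {h : ℝ} (hh : 0 < h) :
    ∫⁻ x, ‖Kh K h x‖ₑ = ENNReal.ofReal (∫ x, |K x|) := by
  rw [← ofReal_integral_norm_eq_lintegral_enorm (Kh_int hK hh)]
  congr 1
  have := Measure.integral_comp_div (fun x => |K x|) h
  simp only [Kh, norm_mul, Real.norm_eq_abs, integral_const_mul, this, smul_eq_mul]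
  rw [abs_inv, ← mul_assoc, inv_mul_cancel₀ (abs_pos.2 hh.ne').ne', one_mul]

lemma Kh_l2 {K : ℝ → ℝ} (hK : MemLp K 2 (volume : Measure ℝ)) {h : ℝ} (hh : 0 < h) :
    ∫⁻ x, ‖Kh K h x‖ₑ ^ 2 < ⊤ := by
  have h1 : Integrable (fun x => (Kh K h x) ^ 2) := by
    have := (hK.integrable_sq.comp_div hh.ne').const_mul ((h⁻¹) ^ 2)
    simpa only [Kh, mul_pow] using this
  have := h1.2
  simpa only [HasFiniteIntegral, enorm_pow] using this

lemma Qker_meas {K : ℝ → ℝ} (hK : Measurable K) (a b : ℝ) :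
    Measurable (fun u : ℝ × ℝ => Qker K a b u.1 u.2) := by
  unfold Qker
  exact ((Kh_measurable hK a).comp measurable_fst).mul ((Kh_measurable hK b).comp measurable_snd)

lemma Q_l1 {K : ℝ → ℝ} (hKm : Measurable K) (hK : Integrable K) {a b : ℝ} (ha : 0 < a)
    (hb : 0 < b) :
    ∫⁻ u : ℝ × ℝ, ‖Qker K a b u.1 u.2‖ₑ = ENNReal.ofReal (∫ x, |K x|) ^ 2 := by
  simp only [Qker, enorm_mul]
  rw [Measure.volume_eq_prod, lintegral_prod_mul (f := fun x => ‖Kh K a x‖ₑ)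
    (g := fun x => ‖Kh K b x‖ₑ) (Kh_measurable hKm a).enorm.aemeasurable
    (Kh_measurable hKm b).enorm.aemeasurable, Kh_l1 hK ha, Kh_l1 hK hb, pow_two]

lemma Q_l2 {K : ℝ → ℝ} (hKm : Measurable K) (hK : MemLp K 2 (volume : Measure ℝ)) {a b : ℝ}
    (ha : 0 < a) (hb : 0 < b) :
    ∫⁻ u : ℝ × ℝ, ‖Qker K a b u.1 u.2‖ₑ ^ 2 < ⊤ := by
  simp only [Qker, enorm_mul, mul_pow]
  rw [Measure.volume_eq_prod, lintegral_prod_mul (f := fun x => ‖Kh K a x‖ₑ ^ 2)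
    (g := fun x => ‖Kh K b x‖ₑ ^ 2) ((Kh_measurable hKm a).enorm.pow_const 2).aemeasurable
    ((Kh_measurable hKm b).enorm.pow_const 2).aemeasurable]
  exact ENNReal.mul_lt_top (Kh_l2 hK ha) (Kh_l2 hK hb)

/-- normalized Lebesgue measure -/
noncomputable def lam (t₀ T : ℝ) : Measure ℝ :=
  ENNReal.ofReal (T - t₀)⁻¹ • volume.restrict (Set.Ioc t₀ T)

instance (t₀ T : ℝ) : IsFiniteMeasure (lam t₀ T) := by
  unfold lam; exact Measure.smul_finite _ ENNReal.ofReal_ne_top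

lemma lam_univ {t₀ T : ℝ} (h : t₀ < T) : lam t₀ T Set.univ = 1 := by
  have : 0 < T - t₀ := by linarith
  simp [lam, ← ENNReal.ofReal_mul (inv_pos.2 this).le, inv_mul_cancel₀ this.ne']

lemma lam_ae (t₀ T : ℝ) : ∀ᵐ s ∂(lam t₀ T), s ∈ Set.Ioc t₀ T :=
  Measure.ae_smul_measure (ae_restrict_mem measurableSet_Ioc) _

lemma lam_integral {t₀ T : ℝ} (h : t₀ < T) (f : ℝ → ℝ) :
    (T - t₀)⁻¹ * ∫ s in t₀..T, f s = ∫ s, f s ∂(lam t₀ T) := by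
  have : 0 < T - t₀ := by linarith
  rw [lam, integral_smul_measure, intervalIntegral.integral_of_le h.le,
    ENNReal.toReal_ofReal (inv_pos.2 this).le, smul_eq_mul]

noncomputable def Wf (K : ℝ → ℝ) (t₀ T t a b : ℝ) (φ : ℝ → ℝ) (z : ℝ × ℝ) : ENNReal :=
  ∫⁻ s, ‖Qker K a b (φ s - z.1) (φ (s + t) - z.2)‖ₑ ∂(lam t₀ T)

lemma PhiMap_eq {K : ℝ → ℝ} {t₀ T t a b : ℝ} (h : t₀ < T) (φ : ℝ → ℝ) (z : ℝ × ℝ) :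
    PhiMap K t₀ T t a b φ z =
      ∫ s, Qker K a b (φ s - z.1) (φ (s + t) - z.2) ∂(lam t₀ T) := lam_integral h _

lemma Phi_le_W {K : ℝ → ℝ} {t₀ T t a b : ℝ} (h : t₀ < T) (φ : ℝ → ℝ) (z : ℝ × ℝ) :
    ‖PhiMap K t₀ T t a b φ z‖ₑ ≤ Wf K t₀ T t a b φ z := by
  rw [PhiMap_eq h]; exact enorm_integral_le_lintegral_enorm _

lemma joint_meas {α : Type*} [MeasurableSpace α] {K : ℝ → ℝ} (hK : Measurable K) (t a b : ℝ)
    {Y : α → ℝ → ℝ} (hY : Measurable (fun q : α × ℝ => Y q.1 q.2)) :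
    Measurable (fun q : (α × (ℝ × ℝ)) × ℝ =>
      Qker K a b (Y q.1.1 q.2 - q.1.2.1) (Y q.1.1 (q.2 + t) - q.1.2.2)) := by
  have h1 : Measurable (fun q : (α × (ℝ × ℝ)) × ℝ => Y q.1.1 q.2) :=
    hY.comp (g := fun q : α × ℝ => Y q.1 q.2)
      (f := fun q : (α × (ℝ × ℝ)) × ℝ => (q.1.1, q.2)) (by fun_prop)
  have h2 : Measurable (fun q : (α × (ℝ × ℝ)) × ℝ => Y q.1.1 (q.2 + t)) :=
    hY.comp (g := fun q : α × ℝ => Y q.1 q.2)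
      (f := fun q : (α × (ℝ × ℝ)) × ℝ => (q.1.1, q.2 + t)) (by fun_prop)
  exact (Qker_meas hK a b).comp (f := fun q : (α × (ℝ × ℝ)) × ℝ =>
    (Y q.1.1 q.2 - q.1.2.1, Y q.1.1 (q.2 + t) - q.1.2.2)) (by fun_prop)

lemma Phi_meas {α : Type*} [MeasurableSpace α] {K : ℝ → ℝ} (hK : Measurable K)
    {t₀ T : ℝ} (h : t₀ < T) (t a b : ℝ)
    {Y : α → ℝ → ℝ} (hY : Measurable (fun q : α × ℝ => Y q.1 q.2)) :
    Measurable (fun q : α × (ℝ × ℝ) => PhiMap K t₀ T t a b (Y q.1) q.2) := by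
  simp only [PhiMap_eq h]
  exact (StronglyMeasurable.integral_prod_right (ν := lam t₀ T)
    (joint_meas hK t a b hY).stronglyMeasurable).measurable

lemma W_meas {α : Type*} [MeasurableSpace α] {K : ℝ → ℝ} (hK : Measurable K)
    (t₀ T t a b : ℝ)
    {Y : α → ℝ → ℝ} (hY : Measurable (fun q : α × ℝ => Y q.1 q.2)) :
    Measurable (fun q : α × (ℝ × ℝ) => Wf K t₀ T t a b (Y q.1) q.2) := by
  unfold Wf
  exact Measurable.lintegral_prod_right' (ν := lam t₀ T) (joint_meas hK t a b hY).enorm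

/-- measurable version of evaluation -/
noncomputable def Gv (φ : ℝ → ℝ) (s : ℝ) : ℝ :=
  Filter.limsup (fun n : ℕ => φ ((⌊s * ((n : ℝ) + 1)⌋ : ℝ) / ((n : ℝ) + 1))) Filter.atTop

lemma Gv_meas : Measurable (fun q : (ℝ → ℝ) × ℝ => Gv q.1 q.2) := by
  unfold Gv
  refine Measurable.limsup fun n => ?_
  have h1 : Measurable (fun q : (ℝ → ℝ) × ℤ => q.1 ((q.2 : ℝ) / ((n : ℝ) + 1))) :=
    measurable_from_prod_countable_left fun y =>
      measurable_pi_apply ((y : ℝ) / ((n : ℝ) + 1))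
  exact h1.comp (f := fun q : (ℝ → ℝ) × ℝ => (q.1, ⌊q.2 * ((n : ℝ) + 1)⌋))
    (measurable_fst.prodMk (Int.measurable_floor.comp (by fun_prop)))

lemma Gv_eq {φ : ℝ → ℝ} {R s : ℝ} (hφ : ContinuousOn φ (Set.Icc 0 R)) (hs : s ∈ Set.Icc 0 R) :
    Gv φ s = φ s := by
  apply Filter.Tendsto.limsup_eq
  refine (hφ s hs).tendsto.comp (tendsto_nhdsWithin_iff.2 ⟨?_, ?_⟩)
  · have h1 : Filter.Tendsto (fun n : ℕ => (⌊s * ((n : ℝ) + 1)⌋ : ℝ) / ((n : ℝ) + 1))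
        Filter.atTop (nhds s) :=
by
      rw [Metric.tendsto_atTop]
      intro ε hε
      obtain ⟨N, hN⟩ := exists_nat_one_div_lt hε
      refine ⟨N, fun n hn => ?_⟩
      have hn1 : (0 : ℝ) < (n : ℝ) + 1 := by positivity
      have hnN : (N : ℝ) ≤ n := by exact_mod_cast hn
      have h2 : 1 / ((n : ℝ) + 1) ≤ 1 / ((N : ℝ) + 1) :=
        one_div_le_one_div_of_le (by positivity) (by linarith)
      have h3 : (⌊s * ((n : ℝ) + 1)⌋ : ℝ) / ((n : ℝ) + 1) ≤ s :=
        (div_le_iff₀ hn1).2 (Int.floor_le _)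
      have h4 : s < (⌊s * ((n : ℝ) + 1)⌋ : ℝ) / ((n : ℝ) + 1) + 1 / ((n : ℝ) + 1) := by
        rw [← add_div, lt_div_iff₀ hn1]
        exact Int.lt_floor_add_one _
      rw [Real.dist_eq, abs_lt]
      constructor <;> linarith
    exact h1
  · refine Filter.Eventually.of_forall fun n => ?_
    have hn : (0 : ℝ) < (n : ℝ) + 1 := by positivity
    refine ⟨div_nonneg ?_ hn.le, ?_⟩
    · exact_mod_cast Int.floor_nonneg.2 (mul_nonneg hs.1 hn.le)
    · exact le_trans ((div_le_iff₀ hn).2 (Int.floor_le _)) hs.2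

lemma Phi_Gv {K : ℝ → ℝ} {t₀ T t a b : ℝ} (ht₀ : 0 ≤ t₀) (h : t₀ < T) (ht : t ∈ Set.Ioc 0 T)
    {φ : ℝ → ℝ} (hφ : ContinuousOn φ (Set.Icc 0 (2 * T))) (z : ℝ × ℝ) :
    PhiMap K t₀ T t a b (Gv φ) z = PhiMap K t₀ T t a b φ z := by
  rw [PhiMap_eq h, PhiMap_eq h]
  apply integral_congr_ae
  filter_upwards [lam_ae t₀ T] with s hs
  obtain ⟨h1, h2⟩ := ht
  obtain ⟨h3, h4⟩ := hs
  rw [Gv_eq hφ ⟨by linarith, by linarith⟩, Gv_eq hφ ⟨by linarith, by linarith⟩]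

lemma W_Gv {K : ℝ → ℝ} {t₀ T t a b : ℝ} (ht₀ : 0 ≤ t₀) (ht : t ∈ Set.Ioc 0 T)
    {φ : ℝ → ℝ} (hφ : ContinuousOn φ (Set.Icc 0 (2 * T))) (z : ℝ × ℝ) :
    Wf K t₀ T t a b (Gv φ) z = Wf K t₀ T t a b φ z := by
  apply lintegral_congr_ae
  filter_upwards [lam_ae t₀ T] with s hs
  obtain ⟨h1, h2⟩ := ht
  obtain ⟨h3, h4⟩ := hs
  rw [Gv_eq hφ ⟨by linarith, by linarith⟩, Gv_eq hφ ⟨by linarith, by linarith⟩]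

lemma W_l1 {K : ℝ → ℝ} (hKm : Measurable K) (hK : Integrable K) {t₀ T t a b : ℝ} (h : t₀ < T)
    (ha : 0 < a) (hb : 0 < b) {φ : ℝ → ℝ} (hφ : Measurable φ) :
    ∫⁻ z, Wf K t₀ T t a b φ z = ENNReal.ofReal (∫ x, |K x|) ^ 2 := by
  unfold Wf
  rw [lintegral_lintegral_swap]
  · have : ∀ s, ∫⁻ z : ℝ × ℝ, ‖Qker K a b (φ s - z.1) (φ (s + t) - z.2)‖ₑ
        = ENNReal.ofReal (∫ x, |K x|) ^ 2 := by
      intro s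
      rw [← Q_l1 hKm hK ha hb]
      exact lintegral_sub_left_eq_self (fun u : ℝ × ℝ => ‖Qker K a b u.1 u.2‖ₑ) (φ s, φ (s + t))
    simp only [this, lintegral_const, lam_univ h, mul_one]
  · have := (joint_meas (α := Unit) hKm t a b (Y := fun _ => φ) (hφ.comp measurable_snd)).comp
      (f := fun q : (ℝ × ℝ) × ℝ => (((), q.1), q.2)) (by fun_prop)
    exact this.enorm.aemeasurable

lemma Phi_l2 {K : ℝ → ℝ} (hKm : Measurable K) {t₀ T t a b : ℝ} (h : t₀ < T)
    {φ : ℝ → ℝ} (hφ : Measurable φ) :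
    ∫⁻ z, ‖PhiMap K t₀ T t a b φ z‖ₑ ^ 2 ≤ ∫⁻ u : ℝ × ℝ, ‖Qker K a b u.1 u.2‖ₑ ^ 2 := by
  have hm : Measurable (fun q : (ℝ × ℝ) × ℝ =>
      ‖Qker K a b (φ q.2 - q.1.1) (φ (q.2 + t) - q.1.2)‖ₑ) := by
    have := (joint_meas (α := Unit) hKm t a b (Y := fun _ => φ) (hφ.comp measurable_snd)).comp
      (f := fun q : (ℝ × ℝ) × ℝ => (((), q.1), q.2)) (by fun_prop)
    exact this.enorm
  calc ∫⁻ z, ‖PhiMap K t₀ T t a b φ z‖ₑ ^ 2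
      ≤ ∫⁻ z : ℝ × ℝ, ∫⁻ s, ‖Qker K a b (φ s - z.1) (φ (s + t) - z.2)‖ₑ ^ 2 ∂(lam t₀ T) := by
        refine lintegral_mono fun z => ?_
        refine (pow_le_pow_left₀ (by positivity) (Phi_le_W h φ z) 2).trans ?_
        have := aux_cs (lam t₀ T) (f := fun _ => 1) measurable_const
          (hm.comp (measurable_prodMk_left (x := z)))
        simpa [lam_univ h, Wf] using this
    _ = ∫⁻ s, (∫⁻ u : ℝ × ℝ, ‖Qker K a b u.1 u.2‖ₑ ^ 2) ∂(lam t₀ T) := by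
        rw [lintegral_lintegral_swap (hm.pow_const 2).aemeasurable]
        refine lintegral_congr fun s => ?_
        exact lintegral_sub_left_eq_self
          (fun u : ℝ × ℝ => ‖Qker K a b u.1 u.2‖ₑ ^ 2) (φ s, φ (s + t))
    _ = _ := by simp [lam_univ h]

lemma EW_le {Ω : Type*} [MeasurableSpace Ω] (P : Measure Ω) [IsProbabilityMeasure P]
    {K : ℝ → ℝ} (hKm : Measurable K) (hK : Integrable K) {t₀ T t : ℝ} (h : t₀ < T)
    {Y : Ω → ℝ → ℝ} (hY : Measurable (fun q : Ω × ℝ => Y q.1 q.2))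
    (pst : ℝ → ℝ → ℝ → ℝ)
    (hpstmeas : Measurable (fun q : ℝ × ℝ × ℝ => pst q.1 q.2.1 q.2.2))
    (hpstpos : ∀ s ξ ζ, 0 ≤ pst s ξ ζ)
    (hdensity : ∀ s ∈ Set.Icc t₀ T,
      P.map (fun ω => (Y ω s, Y ω (s + t))) =
        (volume : Measure (ℝ × ℝ)).withDensity
          (fun z => ENNReal.ofReal (pst s z.1 z.2)))
    (c₁ : ℝ)
    (hstbdd : ∀ ξ ζ : ℝ, |(T - t₀)⁻¹ * ∫ s in t₀..T, pst s ξ ζ| ≤ c₁)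
    {a b : ℝ} (ha : 0 < a) (hb : 0 < b) (z : ℝ × ℝ) :
    ∫⁻ ω, Wf K t₀ T t a b (Y ω) z ∂P ≤
      ENNReal.ofReal c₁ * ENNReal.ofReal (∫ x, |K x|) ^ 2 := by
  have hYs : ∀ s, Measurable (fun ω => Y ω s) := fun s => hY.comp measurable_prodMk_right
  have hp : ∀ s, Measurable (fun u : ℝ × ℝ => ENNReal.ofReal (pst s u.1 u.2)) := fun s =>
    (hpstmeas.comp (measurable_prodMk_left (x := s))).ennreal_ofReal
  have hp2 : Measurable (fun q : ℝ × (ℝ × ℝ) => ENNReal.ofReal (pst q.1 q.2.1 q.2.2)) :=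
    hpstmeas.ennreal_ofReal
  have hqz : Measurable (fun u : ℝ × ℝ => ‖Qker K a b (u.1 - z.1) (u.2 - z.2)‖ₑ) :=
    ((Qker_meas hKm a b).comp (f := fun u : ℝ × ℝ => (u.1 - z.1, u.2 - z.2))
      (by fun_prop)).enorm
  -- a.e. bound on the averaged density
  have hae : ∀ᵐ u : ℝ × ℝ, ∫⁻ s, ENNReal.ofReal (pst s u.1 u.2) ∂(lam t₀ T)
      ≤ ENNReal.ofReal c₁ := by
    have hfin : ∫⁻ u : ℝ × ℝ, ∫⁻ s, ENNReal.ofReal (pst s u.1 u.2) ∂(lam t₀ T) ≠ ⊤ := by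
      rw [lintegral_lintegral_swap (f := fun (u : ℝ × ℝ) s => ENNReal.ofReal (pst s u.1 u.2))
        (hp2.comp measurable_swap).aemeasurable]
      have : ∫⁻ s, (∫⁻ u : ℝ × ℝ, ENNReal.ofReal (pst s u.1 u.2)) ∂(lam t₀ T)
          = ∫⁻ s, 1 ∂(lam t₀ T) := by
        apply lintegral_congr_ae
        filter_upwards [lam_ae t₀ T] with s hs
        have := congrArg (fun m : Measure (ℝ × ℝ) => m Set.univ) (hdensity s ⟨hs.1.le, hs.2⟩)
        rw [Measure.map_apply ((hYs s).prodMk (hYs (s + t))) MeasurableSet.univ,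
          withDensity_apply _ MeasurableSet.univ] at this
        simpa using this.symm
      rw [this]
      simp [lam_univ h]
    have hm : Measurable (fun u : ℝ × ℝ => ∫⁻ s, ENNReal.ofReal (pst s u.1 u.2) ∂(lam t₀ T)) :=
      Measurable.lintegral_prod_right' (ν := lam t₀ T) (hp2.comp measurable_swap)
    filter_upwards [ae_lt_top hm hfin] with u hu
    have hmu : Measurable (fun s => pst s u.1 u.2) :=
      hpstmeas.comp (f := fun s : ℝ => (s, u.1, u.2)) (by fun_prop)
    have hi : Integrable (fun s => pst s u.1 u.2) (lam t₀ T) :=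
      ⟨hmu.aestronglyMeasurable, by
        rw [hasFiniteIntegral_iff_ofReal (Filter.Eventually.of_forall fun s => hpstpos s _ _)]
        exact hu⟩
    rw [← ofReal_integral_eq_lintegral_ofReal hi
      (Filter.Eventually.of_forall fun s => hpstpos s _ _), ← lam_integral h]
    exact ENNReal.ofReal_le_ofReal ((le_abs_self _).trans (hstbdd u.1 u.2))
  have hjm : Measurable (fun q : Ω × ℝ =>
      ‖Qker K a b (Y q.1 q.2 - z.1) (Y q.1 (q.2 + t) - z.2)‖ₑ) :=
    ((joint_meas hKm t a b hY).comp (f := fun q : Ω × ℝ => ((q.1, z), q.2)) (by fun_prop)).enorm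
  calc ∫⁻ ω, Wf K t₀ T t a b (Y ω) z ∂P
      = ∫⁻ s, ∫⁻ ω, ‖Qker K a b (Y ω s - z.1) (Y ω (s + t) - z.2)‖ₑ ∂P ∂(lam t₀ T) := by
        unfold Wf
        exact lintegral_lintegral_swap hjm.aemeasurable
    _ = ∫⁻ s, (∫⁻ u : ℝ × ℝ, ENNReal.ofReal (pst s u.1 u.2) *
          ‖Qker K a b (u.1 - z.1) (u.2 - z.2)‖ₑ) ∂(lam t₀ T) := by
        apply lintegral_congr_ae
        filter_upwards [lam_ae t₀ T] with s hs
        rw [← lintegral_map (f := fun u : ℝ × ℝ => ‖Qker K a b (u.1 - z.1) (u.2 - z.2)‖ₑ)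
          (g := fun ω => (Y ω s, Y ω (s + t))) hqz ((hYs s).prodMk (hYs (s + t))),
          hdensity s ⟨hs.1.le, hs.2⟩, lintegral_withDensity_eq_lintegral_mul _ (hp s) hqz]
        rfl
    _ = ∫⁻ u : ℝ × ℝ, (∫⁻ s, ENNReal.ofReal (pst s u.1 u.2) ∂(lam t₀ T)) *
          ‖Qker K a b (u.1 - z.1) (u.2 - z.2)‖ₑ := by
        rw [lintegral_lintegral_swap (hp2.mul (hqz.comp measurable_snd)).aemeasurable]
        refine lintegral_congr fun u => ?_
        rw [lintegral_mul_const]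
        exact hp2.comp (measurable_prodMk_right (y := u))
    _ ≤ ∫⁻ u : ℝ × ℝ, ENNReal.ofReal c₁ * ‖Qker K a b (u.1 - z.1) (u.2 - z.2)‖ₑ := by
        apply lintegral_mono_ae
        filter_upwards [hae] with u hu
        gcongr
    _ = _ := by
        rw [lintegral_const_mul _ hqz, ← Q_l1 hKm hK ha hb]
        congr 1
        exact lintegral_sub_right_eq_self (fun u : ℝ × ℝ => ‖Qker K a b u.1 u.2‖ₑ) z

set_option maxHeartbeats 1000000 in
/-- Proposition A.2, property (2).
For independent copies `X¹, X², X`,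
`E(⟨Φ_{𝐡,t}(X¹;·), Φ_{𝐥,t}(X²;·)⟩²) ≤ c₁‖K‖₁⁴ E(‖Φ_{𝐥,t}(X;·)‖²)`. -/
theorem Phi_cross_moment_bound
    {Ω : Type*} [MeasurableSpace Ω] (P : Measure Ω) [IsProbabilityMeasure P]
    (K : ℝ → ℝ) (hKmeas : Measurable K)
    (hKint : Integrable K (volume : Measure ℝ))
    (hKsq : MemLp K 2 (volume : Measure ℝ))
    (t₀ T t : ℝ) (ht₀ : 0 ≤ t₀) (htT : t₀ < T) (ht : t ∈ Set.Ioc 0 T)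
    (X : Fin 3 → Ω → ℝ → ℝ)
    (hXmeas : ∀ i, Measurable (fun q : Ω × ℝ => X i q.1 q.2))
    (hXcont : ∀ i ω, ContinuousOn (X i ω) (Set.Icc 0 (2 * T)))
    (hindep : iIndepFun (m := fun _ : Fin 3 => (inferInstance : MeasurableSpace (ℝ → ℝ)))
      (fun i ω => X i ω) P)
    (hident : ∀ i j, IdentDistrib (fun ω => X i ω) (fun ω => X j ω) P P)
    (pst : ℝ → ℝ → ℝ → ℝ)
    (hpstmeas : Measurable (fun q : ℝ × ℝ × ℝ => pst q.1 q.2.1 q.2.2))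
    (hpstpos : ∀ s ξ ζ, 0 ≤ pst s ξ ζ)
    (hdensity : ∀ i, ∀ s ∈ Set.Icc t₀ T,
      P.map (fun ω => (X i ω s, X i ω (s + t))) =
        (volume : Measure (ℝ × ℝ)).withDensity
          (fun z => ENNReal.ofReal (pst s z.1 z.2)))
    (c₁ : ℝ) (hc₁ : 0 < c₁)
    (hstbdd : ∀ ξ ζ : ℝ, |(T - t₀)⁻¹ * ∫ s in t₀..T, pst s ξ ζ| ≤ c₁)
    (h₁ h₂ l₁ l₂ : ℝ) (hh₁ : h₁ ∈ Set.Ioc (0 : ℝ) 1) (hh₂ : h₂ ∈ Set.Ioc (0 : ℝ) 1)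
    (hl₁ : l₁ ∈ Set.Ioc (0 : ℝ) 1) (hl₂ : l₂ ∈ Set.Ioc (0 : ℝ) 1) :
    ∫ ω, (∫ z : ℝ × ℝ,
        PhiMap K t₀ T t h₁ h₂ (X 0 ω) z * PhiMap K t₀ T t l₁ l₂ (X 1 ω) z) ^ 2 ∂P
      ≤ c₁ * (∫ x, |K x|) ^ 4 *
        ∫ ω, (∫ z : ℝ × ℝ, (PhiMap K t₀ T t l₁ l₂ (X 2 ω) z) ^ 2) ∂P := by
  have hX1 : ∀ i ω, Measurable (X i ω) := fun i ω => (hXmeas i).comp measurable_prodMk_left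
  have hPm : ∀ i, Measurable (fun q : Ω × (ℝ × ℝ) => PhiMap K t₀ T t l₁ l₂ (X i q.1) q.2) :=
    fun i => Phi_meas hKmeas htT t l₁ l₂ (hXmeas i)
  have hWm : Measurable (fun q : Ω × (ℝ × ℝ) => Wf K t₀ T t h₁ h₂ (X 0 q.1) q.2) :=
    W_meas hKmeas t₀ T t h₁ h₂ (hXmeas 0)
  set A := ENNReal.ofReal (∫ x, |K x|) with hA
  set S : ENNReal := ∫⁻ ω, (∫⁻ z, ‖PhiMap K t₀ T t l₁ l₂ (X 2 ω) z‖ₑ ^ 2) ∂P with hS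
  have hSfin : S < ⊤ := by
    calc S ≤ ∫⁻ ω, (∫⁻ u : ℝ × ℝ, ‖Qker K l₁ l₂ u.1 u.2‖ₑ ^ 2) ∂P :=
          lintegral_mono fun ω => Phi_l2 hKmeas htT (hX1 2 ω)
      _ < ⊤ := by simpa using Q_l2 hKmeas hKsq hl₁.1 hl₂.1
  have hinner : ∀ ω, ∫ z, (PhiMap K t₀ T t l₁ l₂ (X 2 ω) z) ^ 2
      = (∫⁻ z, ‖PhiMap K t₀ T t l₁ l₂ (X 2 ω) z‖ₑ ^ 2).toReal := by
    intro ω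
    have hm : Measurable (fun z => PhiMap K t₀ T t l₁ l₂ (X 2 ω) z) :=
      (hPm 2).comp measurable_prodMk_left
    rw [integral_eq_lintegral_of_nonneg_ae (Filter.Eventually.of_forall fun z => sq_nonneg _)
      (hm.pow_const 2).aestronglyMeasurable]
    congr 1
    refine lintegral_congr fun z => ?_
    rw [← enorm_pow, Real.enorm_of_nonneg (sq_nonneg _)]
  have hRHS : ∫ ω, (∫ z : ℝ × ℝ, (PhiMap K t₀ T t l₁ l₂ (X 2 ω) z) ^ 2) ∂P = S.toReal := by
    simp only [hinner]
    apply integral_toReal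
    · exact (Measurable.lintegral_prod_right' ((hPm 2).enorm.pow_const 2)).aemeasurable
    · exact Filter.Eventually.of_forall fun ω =>
        (Phi_l2 hKmeas htT (hX1 2 ω)).trans_lt (Q_l2 hKmeas hKsq hl₁.1 hl₂.1)
  -- the main estimate
  have hpath : ∀ ω, ‖(∫ z : ℝ × ℝ,
        PhiMap K t₀ T t h₁ h₂ (X 0 ω) z * PhiMap K t₀ T t l₁ l₂ (X 1 ω) z) ^ 2‖ₑ
      ≤ A ^ 2 * ∫⁻ z, Wf K t₀ T t h₁ h₂ (X 0 ω) z * ‖PhiMap K t₀ T t l₁ l₂ (X 1 ω) z‖ₑ ^ 2 := by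
    intro ω
    have hm1 : Measurable (fun z => Wf K t₀ T t h₁ h₂ (X 0 ω) z) :=
      hWm.comp measurable_prodMk_left
    have hm2 : Measurable (fun z => ‖PhiMap K t₀ T t l₁ l₂ (X 1 ω) z‖ₑ) :=
      ((hPm 1).comp measurable_prodMk_left).enorm
    rw [enorm_pow, ← W_l1 hKmeas hKint (t := t) htT hh₁.1 hh₂.1 (hX1 0 ω)]
    refine le_trans (pow_le_pow_left₀ (by positivity) ?_ 2) (aux_cs volume hm1 hm2)
    refine (enorm_integral_le_lintegral_enorm _).trans (lintegral_mono fun z => ?_)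
    rw [enorm_mul]
    gcongr
    exact Phi_le_W htT _ _
  have hE : ∀ z, ∫⁻ ω, Wf K t₀ T t h₁ h₂ (X 0 ω) z * ‖PhiMap K t₀ T t l₁ l₂ (X 1 ω) z‖ₑ ^ 2 ∂P
      ≤ (ENNReal.ofReal c₁ * A ^ 2) * ∫⁻ ω, ‖PhiMap K t₀ T t l₁ l₂ (X 2 ω) z‖ₑ ^ 2 ∂P := by
    intro z
    let F : (ℝ → ℝ) → ENNReal := fun φ => Wf K t₀ T t h₁ h₂ (Gv φ) z
    let H : (ℝ → ℝ) → ENNReal := fun φ => ‖PhiMap K t₀ T t l₁ l₂ (Gv φ) z‖ₑ ^ 2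
    have hF : Measurable F :=
      (W_meas (Y := Gv) hKmeas t₀ T t h₁ h₂ Gv_meas).comp
        (f := fun φ : ℝ → ℝ => (φ, z)) measurable_prodMk_right
    have hH : Measurable H :=
      (((Phi_meas (Y := Gv) hKmeas htT t l₁ l₂ Gv_meas).comp
        (f := fun φ : ℝ → ℝ => (φ, z)) measurable_prodMk_right).enorm.pow_const 2)
    have eF : F ∘ (fun ω => X 0 ω) = fun ω => Wf K t₀ T t h₁ h₂ (X 0 ω) z :=
      funext fun ω => W_Gv ht₀ ht (hXcont 0 ω) z
    have eH : ∀ i, H ∘ (fun ω => X i ω) = fun ω => ‖PhiMap K t₀ T t l₁ l₂ (X i ω) z‖ₑ ^ 2 :=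
      fun i => funext fun ω => by
        simp only [H, Function.comp_apply, Phi_Gv ht₀ htT ht (hXcont i ω)]
    have hi : IndepFun (fun ω => X 0 ω) (fun ω => X 1 ω) P :=
      hindep.indepFun (i := 0) (j := 1) (by decide)
    have hi2 := hi.comp hF hH
    rw [eF, eH] at hi2
    have hid := ((hident 1 2).comp hH).lintegral_eq
    rw [eH, eH] at hid
    have := lintegral_mul_eq_lintegral_mul_lintegral_of_indepFun
      (hWm.comp (measurable_prodMk_right (y := z)))
      (((hPm 1).comp (measurable_prodMk_right (y := z))).enorm.pow_const 2) hi2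
    refine (le_of_eq this).trans ?_
    refine mul_le_mul' ?_ (le_of_eq hid)
    exact EW_le P hKmeas hKint htT (hXmeas 0) pst hpstmeas hpstpos (hdensity 0) c₁ hstbdd
      hh₁.1 hh₂.1 z
  have hmain : ‖∫ ω, (∫ z : ℝ × ℝ,
        PhiMap K t₀ T t h₁ h₂ (X 0 ω) z * PhiMap K t₀ T t l₁ l₂ (X 1 ω) z) ^ 2 ∂P‖ₑ
      ≤ ENNReal.ofReal c₁ * A ^ 4 * S := by
    have hprod : Measurable (fun q : Ω × (ℝ × ℝ) =>
        Wf K t₀ T t h₁ h₂ (X 0 q.1) q.2 * ‖PhiMap K t₀ T t l₁ l₂ (X 1 q.1) q.2‖ₑ ^ 2) :=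
      hWm.mul ((hPm 1).enorm.pow_const 2)
    have hsq2 : Measurable (fun q : Ω × (ℝ × ℝ) =>
        ‖PhiMap K t₀ T t l₁ l₂ (X 2 q.1) q.2‖ₑ ^ 2) := (hPm 2).enorm.pow_const 2
    calc _ ≤ ∫⁻ ω, A ^ 2 * (∫⁻ z, Wf K t₀ T t h₁ h₂ (X 0 ω) z *
              ‖PhiMap K t₀ T t l₁ l₂ (X 1 ω) z‖ₑ ^ 2) ∂P :=
          (enorm_integral_le_lintegral_enorm _).trans (lintegral_mono hpath)
      _ = A ^ 2 * ∫⁻ z, ∫⁻ ω, Wf K t₀ T t h₁ h₂ (X 0 ω) z *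
              ‖PhiMap K t₀ T t l₁ l₂ (X 1 ω) z‖ₑ ^ 2 ∂P := by
          rw [lintegral_const_mul _ (Measurable.lintegral_prod_right' hprod),
            lintegral_lintegral_swap hprod.aemeasurable]
      _ ≤ A ^ 2 * ∫⁻ z, (ENNReal.ofReal c₁ * A ^ 2) *
            ∫⁻ ω, ‖PhiMap K t₀ T t l₁ l₂ (X 2 ω) z‖ₑ ^ 2 ∂P := by
          gcongr with z
          exact hE z
      _ = ENNReal.ofReal c₁ * A ^ 4 * S := by
          have hm3 : Measurable (fun z : ℝ × ℝ =>
              ∫⁻ ω, ‖PhiMap K t₀ T t l₁ l₂ (X 2 ω) z‖ₑ ^ 2 ∂P) :=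
            Measurable.lintegral_prod_right' (hsq2.comp measurable_swap)
          rw [lintegral_const_mul _ hm3, hS,
            lintegral_lintegral_swap (μ := P) (f := fun ω z => ‖PhiMap K t₀ T t l₁ l₂ (X 2 ω) z‖ₑ ^ 2)
               hsq2.aemeasurable]
          ring
  rw [hRHS]
  have hfin : ENNReal.ofReal c₁ * A ^ 4 * S ≠ ⊤ :=
    ENNReal.mul_ne_top (ENNReal.mul_ne_top ENNReal.ofReal_ne_top
      (ENNReal.pow_ne_top ENNReal.ofReal_ne_top)) hSfin.ne
  have h3 := ENNReal.toReal_mono hfin hmain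
  rw [toReal_enorm] at h3
  refine (Real.le_norm_self _).trans (h3.trans (le_of_eq ?_))
  rw [ENNReal.toReal_mul, ENNReal.toReal_mul, ENNReal.toReal_pow, ENNReal.toReal_ofReal hc₁.le,
    ENNReal.toReal_ofReal (integral_nonneg fun x => abs_nonneg _)]
end
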